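/- Let r ∈ ℂ, let φ ∈ BV_loc((a,b), ℂ^{n×n}) and ψ ∈ BV_loc((a,b), ℂ^n). If det(𝟙 − (1−r)Δ_{dφ}(x)) ≠ 0 and det(𝟙 + r Δ_{dφ}(x)) ≠ 0 for all x ∈ (a,b), then for every x₀ ∈ (a,b) and every y₀ ∈ ℂⁿ the initial value problem dy = dφ·y + dψ, y(x₀) = y₀ has a unique solution y in BV_loc^r((a,b), ℂⁿ). If in addition r, φ, ψ and y₀ are real, then the solution is real. -/

import Mathlib

open Set Filter Function MeasureTheory Topology

noncomputable section

/-- The open interval `(a,b) ⊆ ℝ` determined by extended-real endpoints `a`, `b`. -/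
def EI (a b : EReal) : Set ℝ := {x : ℝ | a < (x : EReal) ∧ (x : EReal) < b}

/-- The jump `Δ_{df}(x) = f⁺(x) - f⁻(x)` of a real-valued function. -/
def jump (f : ℝ → ℝ) (x : ℝ) : ℝ := rightLim f x - leftLim f x

/-- The jump `Δ_{df}(x) = f⁺(x) - f⁻(x)` of a complex-valued function. -/
def jumpC (f : ℝ → ℂ) (x : ℝ) : ℂ := rightLim f x - leftLim f x

/-- `θ_z(x) = 1 - z² Δ_{dα}(x) Δ_{dβ}(x)`. -/
def theta (α β : ℝ → ℝ) (z x : ℝ) : ℝ := 1 - z ^ 2 * jump α x * jump β x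

/-- `ω(x) = 1 - Δ_{dα}(x) Δ_{dβ}(x) / 4`. -/
def omegaFn (α β : ℝ → ℝ) (x : ℝ) : ℝ := 1 - jump α x * jump β x / 4

/-- A real-valued function is `r`-balanced on `I`: it is of locally bounded variation and
`f(x) = r f⁻(x) + (1-r) f⁺(x)` for all `x ∈ I`. -/
def RBalanced (r : ℝ) (I : Set ℝ) (f : ℝ → ℝ) : Prop :=
  LocallyBoundedVariationOn f I ∧
    ∀ x ∈ I, f x = r * leftLim f x + (1 - r) * rightLim f x

/-- A complex-valued function is `r`-balanced on `I`. -/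
def RBalancedC (r : ℂ) (I : Set ℝ) (f : ℝ → ℂ) : Prop :=
  LocallyBoundedVariationOn f I ∧
    ∀ x ∈ I, f x = r * leftLim f x + (1 - r) * rightLim f x

/-- `ν` coincides on `[c,d]` with the Lebesgue–Stieltjes measure `df` generated by `f`,
determined by `df((x,y]) = f⁺(y) - f⁺(x)`. -/
def SMRepresents (ν : SignedMeasure ℝ) (f : ℝ → ℝ) (c d : ℝ) : Prop :=
  ∀ x ∈ Icc c d, ∀ y ∈ Icc c d, x ≤ y → ν (Ioc x y) = rightLim f y - rightLim f x

/-- The integral of `h` against the signed measure `ν` over the set `E`. -/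
def sInt (ν : SignedMeasure ℝ) (h : ℝ → ℝ) (E : Set ℝ) : ℝ :=
  (∫ x in E, h x ∂ν.toJordanDecomposition.posPart) -
    (∫ x in E, h x ∂ν.toJordanDecomposition.negPart)

/-- The equality of (locally finite, real Borel) measures `dg = ∑ j, (h j) d(β j)` on the
interval `I`, expressed via localizations to compact subintervals of `I`. -/
def MeasureEqOn (I : Set ℝ) {ι : Type} [Fintype ι] (g : ℝ → ℝ) (h β : ι → ℝ → ℝ) : Prop :=
  ∀ c ∈ I, ∀ d ∈ I, c < d →
    ∃ (νg : SignedMeasure ℝ) (ν : ι → SignedMeasure ℝ),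
      SMRepresents νg g c d ∧ (∀ j, SMRepresents (ν j) (β j) c d) ∧
      ∀ E : Set ℝ, E ⊆ Ioc c d → MeasurableSet E → νg E = ∑ j, sInt (ν j) (h j) E

/-- The equality of complex measures `dg = ∑ j, (h j) d(β j)` on `I`, encoded via real and
imaginary parts. -/
def MeasureEqOnC (I : Set ℝ) {ι : Type} [Fintype ι] (g : ℝ → ℂ) (h β : ι → ℝ → ℂ) : Prop :=
  MeasureEqOn I (fun x => (g x).re)
    (Sum.elim (fun j x => (h j x).re) (fun j x => -(h j x).im))
    (Sum.elim (fun j x => (β j x).re) (fun j x => (β j x).im)) ∧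
  MeasureEqOn I (fun x => (g x).im)
    (Sum.elim (fun j x => (h j x).im) (fun j x => (h j x).re))
    (Sum.elim (fun j x => (β j x).re) (fun j x => (β j x).im))

/-- The support of `dα` is all of `I`: no open subinterval of `I` is `dα`-null, i.e. on no
open subinterval of `I` do all one-sided limits of `α` coincide with a single constant. -/
def SuppFull (I : Set ℝ) (α : ℝ → ℂ) : Prop :=
  ∀ x ∈ I, ∀ ε > (0 : ℝ), Icc (x - ε) (x + ε) ⊆ I →
    ¬ (∀ p ∈ Ioo (x - ε) (x + ε), ∀ q ∈ Ioo (x - ε) (x + ε),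
        rightLim α p = rightLim α q ∧ leftLim α p = rightLim α q)

/-- `u`, together with the representative `w` of `du/dα`, is an `r`-balanced solution of the
homogeneous equation `-d(du/dα) + u dβ = 0` on `I`: `u` and `w` are `r`-balanced,
`du = w dα` (so `du ≪ dα` with `du/dα = w`), and `dw = u dβ`. -/
def IsHomSol (I : Set ℝ) (r : ℝ) (α β u w : ℝ → ℝ) : Prop :=
  RBalanced r I u ∧ RBalanced r I w ∧
  MeasureEqOn I u (fun _ : Fin 1 => w) (fun _ => α) ∧
  MeasureEqOn I w (fun _ : Fin 1 => u) (fun _ => β)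

/-- `u`, together with the representative `w` of `du/dα`, is an `r`-balanced solution of
`-d(du/dα) + u dβ = dη` on `I` (complex-valued coefficients): `dw = u dβ - dη`. -/
def IsSolC (I : Set ℝ) (r : ℂ) (α β η u w : ℝ → ℂ) : Prop :=
  RBalancedC r I u ∧ RBalancedC r I w ∧
  MeasureEqOnC I u (fun _ : Fin 1 => w) (fun _ => α) ∧
  MeasureEqOnC I w ![u, fun _ => (-1 : ℂ)] ![β, η]

/-- `y` solves the linear system `dy = dφ · y + dψ` on `I`, componentwise:
`d(y i) = ∑ j, (y j) d(φ i j) + dψ i`. -/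
def IsSysSolC (I : Set ℝ) (n : ℕ) (φ : ℝ → Matrix (Fin n) (Fin n) ℂ)
    (ψ : ℝ → Fin n → ℂ) (y : ℝ → Fin n → ℂ) : Prop :=
  ∀ i : Fin n,
    MeasureEqOnC I (fun x => y x i)
      (Sum.elim (fun j : Fin n => fun x => y x j) (fun _ : Unit => fun _ => (1 : ℂ)))
      (Sum.elim (fun j : Fin n => fun x => φ x i j) (fun _ : Unit => fun x => ψ x i))

/-- `Z_I(f) = {x ∈ I : f⁻(x) f⁺(x) ≤ 0}`, the set of sign-changing points of `f` in `I`. -/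
def ZSet (f : ℝ → ℝ) (I : Set ℝ) : Set ℝ := {x ∈ I | leftLim f x * rightLim f x ≤ 0}

/-- `u` changes sign at `s ∈ I`. -/
def ChangesSignAt (I : Set ℝ) (u : ℝ → ℝ) (s : ℝ) : Prop :=
  ∃ δ > (0 : ℝ), Ioo (s - δ) (s + δ) ⊆ I ∧
    (((∀ x ∈ Ioo (s - δ) s, leftLim u x < 0) ∧ ∀ x ∈ Ioo s (s + δ), 0 < rightLim u x) ∨
     ((∀ x ∈ Ioo (s - δ) s, 0 < leftLim u x) ∧ ∀ x ∈ Ioo s (s + δ), rightLim u x < 0))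

/-- `u` changes sign in `J` (a subinterval of `I`). -/
def ChangesSignIn (I : Set ℝ) (u : ℝ → ℝ) (J : Set ℝ) : Prop :=
  ∃ s ∈ J, ChangesSignAt I u s

/-- `u` and `v` are linearly dependent on `I`. -/
def LinDepOn (I : Set ℝ) (u v : ℝ → ℝ) : Prop :=
  ∃ c₁ c₂ : ℝ, ¬(c₁ = 0 ∧ c₂ = 0) ∧ ∀ x ∈ I, c₁ * u x + c₂ * v x = 0

/-- The Lebesgue–Stieltjes measure `dg` is nonnegative on (Borel subsets of) `S`, expressed by
nonnegativity on all subintervals of `S` of each of the four kinds. -/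
def PosMeasureOn (g : ℝ → ℝ) (S : Set ℝ) : Prop :=
  (∀ x y : ℝ, x ≤ y → Icc x y ⊆ S → 0 ≤ rightLim g y - leftLim g x) ∧
  (∀ x y : ℝ, x ≤ y → Ico x y ⊆ S → 0 ≤ leftLim g y - leftLim g x) ∧
  (∀ x y : ℝ, x ≤ y → Ioc x y ⊆ S → 0 ≤ rightLim g y - rightLim g x) ∧
  (∀ x y : ℝ, x < y → Ioo x y ⊆ S → 0 ≤ leftLim g y - rightLim g x)

section

open scoped ENNReal

/-- The iterated Volterra integrals `I₀ = 1`, `Iₙ₊₁(t) = ∫_{R s t} Iₙ(s) dν(s)`. -/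
def iterVolterra {X : Type*} [MeasurableSpace X] (R : X → X → Prop) (ν : Measure X) :
    ℕ → X → ℝ≥0∞
  | 0 => fun _ => 1
  | n + 1 => fun t => ∫⁻ s in {s | R s t}, iterVolterra R ν n s ∂ν

section Volterra

variable {X : Type*} [MeasurableSpace X] {R : X → X → Prop}

lemma iterVolterra_succ (R : X → X → Prop) (ν : Measure X) (n : ℕ) (t : X) :
    iterVolterra R ν (n + 1) t = ∫⁻ s in {s | R s t}, iterVolterra R ν n s ∂ν := rfl

lemma measurableSet_rel_left (hR : MeasurableSet {p : X × X | R p.1 p.2}) (t : X) :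
    MeasurableSet {s | R s t} :=
  measurable_prodMk_right hR

lemma measurable_iterVolterra (hR : MeasurableSet {p : X × X | R p.1 p.2})
    (ν : Measure X) [SFinite ν] (n : ℕ) : Measurable (iterVolterra R ν n) := by
  induction n with
  | zero => exact measurable_const
  | succ n ih =>
    have h : Measurable (({p : X × X | R p.1 p.2}).indicator
        (fun p => iterVolterra R ν n p.1)) := (ih.comp measurable_fst).indicator hR
    have h2 := h.lintegral_prod_left' (μ := ν)
    convert h2 using 1
    funext t
    rw [iterVolterra_succ, ← lintegral_indicator (measurableSet_rel_left hR t)]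
    rfl

lemma succ_mul_iterVolterra_le (hR : MeasurableSet {p : X × X | R p.1 p.2})
    (htrans : ∀ s t u, R s t → R t u → R s u) (hirr : ∀ s, ¬ R s s)
    (ν : Measure X) [SFinite ν] (n : ℕ) (t : X) :
    (n + 1 : ℝ≥0∞) * iterVolterra R ν (n + 1) t ≤ ν {s | R s t} * iterVolterra R ν n t := by
  induction n generalizing t with
  | zero => simp [iterVolterra]
  | succ n ih =>
    set I := iterVolterra R ν n with hI
    have hIm : Measurable I := measurable_iterVolterra hR ν n
    have hIm2 : Measurable (fun p : X × X => I p.2) := hIm.comp measurable_snd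
    have hRs : MeasurableSet {p : X × X | R p.2 p.1} := measurable_swap hR
    have hSt : MeasurableSet {s | R s t} := measurableSet_rel_left hR t
    set A : Set (X × X) := {p | R p.2 p.1} ∩ {p | R p.1 t} with hA
    set B : Set (X × X) := {p | R p.1 p.2} ∩ {p | R p.2 t} with hB
    have hAm : MeasurableSet A := hRs.inter (measurable_fst hSt)
    have hBm : MeasurableSet B := hR.inter (measurable_snd hSt)
    have hdisj : Disjoint A B := by
      rw [Set.disjoint_left]
      rintro ⟨p, q⟩ ⟨h1, -⟩ ⟨h2, -⟩
      exact hirr _ (htrans _ _ _ h1 h2)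
    have hsub : A ∪ B ⊆ {s | R s t} ×ˢ {s | R s t} := by
      rintro ⟨p, q⟩ (⟨h1, h2⟩ | ⟨h1, h2⟩)
      · exact ⟨h2, htrans _ _ _ h1 h2⟩
      · exact ⟨htrans _ _ _ h1 h2, h2⟩
    have e0 : ν {s | R s t} * iterVolterra R ν (n + 1) t
        = ∫⁻ p in {s | R s t} ×ˢ {s | R s t}, I p.2 ∂(ν.prod ν) := by
      rw [← Measure.prod_restrict, lintegral_prod _ hIm2.aemeasurable]
      simp [iterVolterra, hI, mul_comm]
    have eA : ∫⁻ p in A, I p.2 ∂(ν.prod ν) = iterVolterra R ν (n + 2) t := by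
      rw [← lintegral_indicator hAm,
        lintegral_prod _ (hIm2.indicator hAm).aemeasurable]
      rw [iterVolterra_succ, ← lintegral_indicator hSt]
      congr 1
      funext p
      by_cases hp : R p t
      · rw [Set.indicator_of_mem (s := {s | R s t}) hp, iterVolterra_succ,
          ← lintegral_indicator (measurableSet_rel_left hR p)]
        congr 1
        funext q
        by_cases hq : R q p <;> simp [Set.indicator, hA, hp, hq, hI]
      · simp [Set.indicator, hA, hp]
    have eB : ∫⁻ p in B, I p.2 ∂(ν.prod ν) = ∫⁻ s in {s | R s t}, ν {q | R q s} * I s ∂ν := by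
      rw [← lintegral_indicator hBm,
        lintegral_prod_symm _ (hIm2.indicator hBm).aemeasurable,
        ← lintegral_indicator hSt]
      congr 1
      funext q
      by_cases hq : R q t
      · rw [Set.indicator_of_mem (s := {s | R s t}) hq, mul_comm,
          ← lintegral_indicator_const (measurableSet_rel_left hR q)]
        congr 1
        funext p
        by_cases hp : R p q <;> simp [Set.indicator, hB, hp, hq]
      · simp [Set.indicator, hB, hq]
    calc ((n + 1 : ℕ) + 1 : ℝ≥0∞) * iterVolterra R ν (n + 1 + 1) t
        = iterVolterra R ν (n + 2) t
          + ∫⁻ s in {s | R s t}, (n + 1) * iterVolterra R ν (n + 1) s ∂ν := by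
          rw [lintegral_const_mul _ (measurable_iterVolterra hR ν (n + 1))]
          change _ = _ + (n + 1 : ℝ≥0∞) * iterVolterra R ν (n + 2) t
          push_cast
          ring
      _ ≤ iterVolterra R ν (n + 2) t + ∫⁻ s in {s | R s t}, ν {q | R q s} * I s ∂ν := by
          exact add_le_add le_rfl (lintegral_mono fun s => ih s)
      _ = ∫⁻ p in A ∪ B, I p.2 ∂(ν.prod ν) := by
          rw [lintegral_union hBm hdisj, eA, eB]
      _ ≤ ∫⁻ p in {s | R s t} ×ˢ {s | R s t}, I p.2 ∂(ν.prod ν) :=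
          lintegral_mono_set hsub
      _ = _ := e0.symm

lemma iterVolterra_le (hR : MeasurableSet {p : X × X | R p.1 p.2})
    (htrans : ∀ s t u, R s t → R t u → R s u) (hirr : ∀ s, ¬ R s s)
    (ν : Measure X) [IsFiniteMeasure ν] (n : ℕ) (t : X) :
    iterVolterra R ν n t ≤ ENNReal.ofReal (ν.real univ ^ n / n.factorial) := by
  induction n with
  | zero => simp [iterVolterra]
  | succ n ih =>
    have h := succ_mul_iterVolterra_le hR htrans hirr ν n t
    have h2 : (n + 1 : ℝ≥0∞) * iterVolterra R ν (n + 1) t ≤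
        ENNReal.ofReal (ν.real univ) * ENNReal.ofReal (ν.real univ ^ n / n.factorial) := by
      refine h.trans ?_
      gcongr
      rw [ofReal_measureReal]
      exact measure_mono (subset_univ _)
    rw [← ENNReal.ofReal_mul (by positivity)] at h2
    have h3 : iterVolterra R ν (n + 1) t ≤
        ENNReal.ofReal (ν.real univ * (ν.real univ ^ n / n.factorial)) / (n + 1 : ℝ≥0∞) := by
      rw [ENNReal.le_div_iff_mul_le (by simp) (by simp), mul_comm]
      exact h2
    refine h3.trans (le_of_eq ?_)
    have : (n + 1 : ℝ≥0∞) = ENNReal.ofReal (n + 1) := by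
      rw [ENNReal.ofReal_add (by positivity) (by positivity)]; simp
    rw [this, ← ENNReal.ofReal_div_of_pos (by positivity)]
    congr 1
    rw [Nat.factorial_succ]
    push_cast
    field_simp
    ring

lemma tendsto_iterVolterra (hR : MeasurableSet {p : X × X | R p.1 p.2})
    (htrans : ∀ s t u, R s t → R t u → R s u) (hirr : ∀ s, ¬ R s s)
    (ν : Measure X) [IsFiniteMeasure ν] (t : X) :
    Tendsto (fun n => iterVolterra R ν n t) atTop (𝓝 0) := by
  refine tendsto_of_tendsto_of_tendsto_of_le_of_le tendsto_const_nhds ?_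
    (fun _ => zero_le) (fun n => iterVolterra_le hR htrans hirr ν n t)
  have := (FloorSemiring.tendsto_pow_div_factorial_atTop (ν.real univ))
  simpa using ENNReal.tendsto_ofReal this

lemma volterra_eq_zero (hR : MeasurableSet {p : X × X | R p.1 p.2})
    (htrans : ∀ s t u, R s t → R t u → R s u) (hirr : ∀ s, ¬ R s s)
    {μ : Measure X} {k : X → ℝ≥0∞} (hk : Measurable k) (hkfin : ∫⁻ s, k s ∂μ ≠ ∞)
    {w : X → ℝ≥0∞} {B : ℝ≥0∞} (hB : B ≠ ∞) (hwB : ∀ t, w t ≤ B)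
    (hw : ∀ t, w t ≤ ∫⁻ s in {s | R s t}, k s * w s ∂μ) (t : X) : w t = 0 := by
  have : IsFiniteMeasure (μ.withDensity k) := isFiniteMeasure_withDensity hkfin
  have key : ∀ n t, w t ≤ B * iterVolterra R (μ.withDensity k) n t := by
    intro n
    induction n with
    | zero => intro t; simpa [iterVolterra] using hwB t
    | succ n ih =>
      intro t
      have hm := measurable_iterVolterra hR (μ.withDensity k) n
      calc w t ≤ ∫⁻ s in {s | R s t}, k s * w s ∂μ := hw t
        _ ≤ ∫⁻ s in {s | R s t}, k s * (B * iterVolterra R (μ.withDensity k) n s) ∂μ := by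
            gcongr with s
            exact ih s
        _ = B * iterVolterra R (μ.withDensity k) (n + 1) t := by
            rw [iterVolterra_succ, restrict_withDensity (measurableSet_rel_left hR t),
              lintegral_withDensity_eq_lintegral_mul _ hk hm, ← lintegral_const_mul _ (hk.mul hm)]
            congr 1
            funext s
            simp only [Pi.mul_apply]
            ring
  have hlim := ENNReal.Tendsto.const_mul (a := B)
    (tendsto_iterVolterra hR htrans hirr (μ.withDensity k) t) (Or.inr hB)
  rw [mul_zero] at hlim
  exact le_antisymm (ge_of_tendsto' hlim (fun n => key n t)) zero_le

variable {E : Type*} [NormedAddCommGroup E] [NormedSpace ℂ E]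

lemma stronglyMeasurable_setIntegral_rel (hR : MeasurableSet {p : X × X | R p.1 p.2})
    {μ : Measure X} [SFinite μ] {f : X → E} (hf : StronglyMeasurable f) :
    StronglyMeasurable (fun t => ∫ s in {s | R s t}, f s ∂μ) := by
  have h : StronglyMeasurable (({p : X × X | R p.1 p.2}).indicator (fun p => f p.1)) :=
    (hf.comp_measurable measurable_fst).indicator hR
  have h2 := h.integral_prod_left' (μ := μ)
  convert h2 using 1
  funext t
  rw [← integral_indicator (measurableSet_rel_left hR t)]
  rfl

/-- Solvability of linear Volterra equations with respect to a transitive irreflexive relation. -/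
lemma exists_volterra [CompleteSpace E] (hR : MeasurableSet {p : X × X | R p.1 p.2})
    (htrans : ∀ s t u, R s t → R t u → R s u) (hirr : ∀ s, ¬ R s s)
    {μ : Measure X} [SFinite μ] {K : X → E →L[ℂ] E} (hK : StronglyMeasurable K)
    (hKi : Integrable K μ) {g : X → E} (hg : StronglyMeasurable g) {C : ℝ}
    (hC : ∀ t, ‖g t‖ ≤ C) :
    ∃ z : X → E, StronglyMeasurable z ∧ (∃ B : ℝ, ∀ t, ‖z t‖ ≤ B) ∧
      ∀ t, z t = g t + ∫ s in {s | R s t}, K s (z s) ∂μ := by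
  set k : X → ℝ≥0∞ := fun s => ‖K s‖ₑ with hk
  have hkm : Measurable k := hK.enorm
  set ν := μ.withDensity k with hν
  have : IsFiniteMeasure ν := isFiniteMeasure_withDensity hKi.2.ne
  set m := ν.real univ
  let Z : ℕ → X → E := fun n => Nat.rec g
    (fun _ f t => ∫ s in {s | R s t}, K s (f s) ∂μ) n
  have hZ0 : Z 0 = g := rfl
  have hZs : ∀ n t, Z (n + 1) t = ∫ s in {s | R s t}, K s (Z n s) ∂μ := fun n t => rfl
  have hZm : ∀ n, StronglyMeasurable (Z n) := by
    intro n
    induction n with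
    | zero => exact hg
    | succ n ih =>
      exact stronglyMeasurable_setIntegral_rel hR (isBoundedBilinearMap_apply.continuous.comp_stronglyMeasurable (hK.prodMk ih))
  have hZb : ∀ n t, ‖Z n t‖ₑ ≤ ENNReal.ofReal C * iterVolterra R ν n t := by
    intro n
    induction n with
    | zero =>
      intro t
      simp only [iterVolterra, mul_one, hZ0]
      rw [← ofReal_norm]
      exact ENNReal.ofReal_le_ofReal (hC t)
    | succ n ih =>
      intro t
      have hm := measurable_iterVolterra hR ν n
      calc ‖Z (n + 1) t‖ₑ ≤ ∫⁻ s in {s | R s t}, ‖K s (Z n s)‖ₑ ∂μ :=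
            enorm_integral_le_lintegral_enorm _
        _ ≤ ∫⁻ s in {s | R s t}, k s * (ENNReal.ofReal C * iterVolterra R ν n s) ∂μ := by
            gcongr with s
            refine ((K s).le_opENorm _).trans ?_
            gcongr
            exact ih s
        _ = ENNReal.ofReal C * iterVolterra R ν (n + 1) t := by
            rw [iterVolterra_succ, hν, restrict_withDensity (measurableSet_rel_left hR t),
              lintegral_withDensity_eq_lintegral_mul _ hkm (by exact hm),
              ← lintegral_const_mul _ (hkm.mul (by exact hm))]
            congr 1
            funext s
            simp only [Pi.mul_apply]
            ring
  have hC' : 0 ≤ max C 0 := le_max_right _ _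
  have hZr : ∀ n t, ‖Z n t‖ ≤ max C 0 * (m ^ n / n.factorial) := by
    intro n t
    have h1 : ‖Z n t‖ₑ ≤ ENNReal.ofReal (max C 0 * (m ^ n / n.factorial)) := by
      rw [ENNReal.ofReal_mul hC']
      refine (hZb n t).trans ?_
      gcongr
      · exact le_max_left _ _
      · exact iterVolterra_le hR htrans hirr ν n t
    rw [← ofReal_norm] at h1
    exact (ENNReal.ofReal_le_ofReal_iff (by positivity)).1 h1
  have hsum : Summable (fun n : ℕ => max C 0 * (m ^ n / n.factorial)) :=
    (Real.summable_pow_div_factorial m).mul_left _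
  have hZsum : ∀ t, Summable (fun n => Z n t) := fun t =>
    Summable.of_norm_bounded hsum (fun n => hZr n t)
  refine ⟨fun t => ∑' n, Z n t, ?_, ⟨∑' n : ℕ, max C 0 * (m ^ n / n.factorial), ?_⟩, ?_⟩
  · refine stronglyMeasurable_of_tendsto atTop (f := fun N t => ∑ n ∈ Finset.range N, Z n t)
      (fun N => Finset.stronglyMeasurable_fun_sum _ (fun n _ => hZm n)) ?_
    rw [tendsto_pi_nhds]
    exact fun t => (hZsum t).hasSum.tendsto_sum_nat
  · exact fun t => tsum_of_norm_bounded hsum.hasSum (fun n => hZr n t)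
  · intro t
    have h := hasSum_integral_of_dominated_convergence (μ := μ.restrict {s | R s t})
      (F := fun n s => K s (Z n s)) (f := fun s => K s (∑' n, Z n s))
      (fun n s => ‖K s‖ * (max C 0 * (m ^ n / n.factorial)))
      (fun n => (isBoundedBilinearMap_apply.continuous.comp_stronglyMeasurable
        (hK.prodMk (hZm n))).aestronglyMeasurable)
      (fun n => Eventually.of_forall fun s => ((K s).le_opNorm _).trans
        (by gcongr; exact hZr n s))
      (Eventually.of_forall fun s => hsum.mul_left _)
      (by
        simp_rw [tsum_mul_left]
        exact (hKi.norm.mul_const _).integrableOn)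
      (Eventually.of_forall fun s => (K s).hasSum (hZsum s).hasSum)
    change ∑' n, Z n t = g t + _
    rw [(hZsum t).tsum_eq_zero_add, ← h.tsum_eq]
    rfl

end Volterra

lemma StronglyMeasurable.of_countable_ne {X F : Type*} [MeasurableSpace X]
    [MeasurableSingletonClass X] [TopologicalSpace F] [TopologicalSpace.PseudoMetrizableSpace F]
    {f g : X → F} (hf : StronglyMeasurable f) (h : {x | f x ≠ g x}.Countable) :
    StronglyMeasurable g := by
  borelize F
  rw [stronglyMeasurable_iff_measurable_separable] at hf ⊢
  refine ⟨hf.1.measurable_of_countable_ne h, ?_⟩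
  refine (hf.2.union (h.image g).isSeparable).mono ?_
  rintro _ ⟨x, rfl⟩
  by_cases hx : f x = g x
  · exact Or.inl ⟨x, hx⟩
  · exact Or.inr ⟨x, hx, rfl⟩

lemma finite_le_measure_singleton (ν : Measure ℝ) [IsFiniteMeasure ν] {ε : ℝ≥0∞} (hε : 0 < ε) :
    {t : ℝ | ε ≤ ν {t}}.Finite :=
  Measure.finite_const_le_meas_of_disjoint_iUnion ν hε (As := fun t : ℝ => ({t} : Set ℝ))
    (fun t => measurableSet_singleton t) (fun s t hst => by simpa [Function.onFun] using hst)
    (measure_ne_top _ _)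

lemma countable_measure_singleton_ne_zero (ν : Measure ℝ) [IsFiniteMeasure ν] :
    {t : ℝ | ν.real {t} ≠ 0}.Countable := by
  have := Measure.countable_meas_pos_of_disjoint_iUnion (μ := ν) (As := fun t : ℝ => ({t} : Set ℝ))
    (fun t => measurableSet_singleton t) (fun s t hst => by simpa [Function.onFun] using hst)
  refine this.mono fun t ht => ?_
  rw [mem_ofPred_eq, pos_iff_ne_zero]
  intro h0
  exact ht (by simp [measureReal_def, h0])

/-- The `r`-balanced primitive `C + r ∫_{s<t} G + (1-r) ∫_{s≤t} G`. -/
def balPrim {E : Type*} [NormedAddCommGroup E] [NormedSpace ℂ E] (r : ℂ) (μ : Measure ℝ)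
    (C : E) (G : ℝ → E) (t : ℝ) : E :=
  C + r • (∫ s in Iio t, G s ∂μ) + (1 - r) • ∫ s in Iic t, G s ∂μ

set_option linter.unusedSectionVars false

section Prim

variable {E : Type*} [NormedAddCommGroup E] [NormedSpace ℂ E] {r : ℂ} {μ : Measure ℝ}
  [IsFiniteMeasure μ] {C : E} {G : ℝ → E}

lemma setIntegral_Iic_eq [CompleteSpace E] (hG : Integrable G μ) (x : ℝ) :
    ∫ s in Iic x, G s ∂μ = (∫ s in Iio x, G s ∂μ) + (μ.real {x} : ℂ) • G x := by
  have : Iic x = Iio x ∪ {x} := by simp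
  rw [this, setIntegral_union (by simp) (measurableSet_singleton x) hG.integrableOn
    hG.integrableOn, integral_singleton]
  simp

lemma setIntegral_Iio_eq (hG : Integrable G μ) {x t : ℝ} (h : x < t) :
    ∫ s in Iio t, G s ∂μ = (∫ s in Iic x, G s ∂μ) + ∫ s in Ioo x t, G s ∂μ := by
  rw [← Iic_union_Ioo_eq_Iio h, setIntegral_union _ measurableSet_Ioo hG.integrableOn
    hG.integrableOn]
  rw [Set.disjoint_left]
  intro s hs hs2
  exact absurd hs2.1 (not_lt.2 hs)

lemma balPrim_sub [CompleteSpace E] (hG : Integrable G μ) {x t : ℝ} (h : x < t) :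
    balPrim r μ C G t = balPrim r μ C G x + ((r * μ.real {x}) • G x + (∫ s in Ioo x t, G s ∂μ) +
      ((1 - r) * μ.real {t}) • G t) := by
  simp only [balPrim]
  rw [setIntegral_Iic_eq hG t, setIntegral_Iic_eq hG x, setIntegral_Iio_eq hG h,
    setIntegral_Iic_eq hG x]
  module

lemma norm_balPrim_le (hG : Integrable G μ) (t : ℝ) :
    ‖balPrim r μ C G t‖ ≤ ‖C‖ + ‖r‖ * (∫ s, ‖G s‖ ∂μ) + ‖1 - r‖ * ∫ s, ‖G s‖ ∂μ := by
  have key : ∀ S : Set ℝ, ‖∫ s in S, G s ∂μ‖ ≤ ∫ s, ‖G s‖ ∂μ := fun S =>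
    (norm_integral_le_integral_norm _).trans
      (setIntegral_le_integral hG.norm (Eventually.of_forall fun s => norm_nonneg _))
  refine (norm_add_le _ _).trans (add_le_add ((norm_add_le _ _).trans ?_) ?_)
  · rw [norm_smul]
    gcongr
    exact key _
  · rw [norm_smul]
    gcongr
    exact key _

end Prim

/-- `s` lies strictly between `x₀` and `t`. -/
def StrictBtw (x₀ s t : ℝ) : Prop := (x₀ < s ∧ s < t) ∨ (t < s ∧ s < x₀)

/-- The orientation sign relative to `x₀`. -/
def btwSign (x₀ s : ℝ) : ℂ := if x₀ < s then 1 else -1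

/-- The weight with which the endpoint `t` enters an `r`-balanced integral from `x₀` to `t`. -/
def endWeight (r : ℂ) (μ : Measure ℝ) (x₀ t : ℝ) : ℂ :=
  if x₀ < t then (1 - r) * μ.real {t} else if t < x₀ then -(r * μ.real {t}) else 0

/-- The weight with which the endpoint `x₀` enters an `r`-balanced integral from `x₀` to `t`. -/
def startWeight (r : ℂ) (μ : Measure ℝ) (x₀ t : ℝ) : ℂ :=
  if x₀ < t then r * μ.real {x₀} else if t < x₀ then -((1 - r) * μ.real {x₀}) else 0

lemma measurableSet_strictBtw (x₀ : ℝ) : MeasurableSet {p : ℝ × ℝ | StrictBtw x₀ p.1 p.2} := by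
  have h1 : MeasurableSet {p : ℝ × ℝ | x₀ < p.1} := measurableSet_lt measurable_const measurable_fst
  have h2 : MeasurableSet {p : ℝ × ℝ | p.1 < p.2} := measurableSet_lt measurable_fst measurable_snd
  have h3 : MeasurableSet {p : ℝ × ℝ | p.2 < p.1} := measurableSet_lt measurable_snd measurable_fst
  have h4 : MeasurableSet {p : ℝ × ℝ | p.1 < x₀} := measurableSet_lt measurable_fst measurable_const
  exact (h1.inter h2).union (h3.inter h4)

lemma strictBtw_trans (x₀ s t u : ℝ) : StrictBtw x₀ s t → StrictBtw x₀ t u → StrictBtw x₀ s u := by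
  rintro (⟨h1, h2⟩ | ⟨h1, h2⟩) (⟨h3, h4⟩ | ⟨h3, h4⟩)
  · exact Or.inl ⟨h1, h2.trans h4⟩
  · exact absurd (h1.trans h2) h4.not_gt
  · exact absurd (h1.trans h2) h3.not_gt
  · exact Or.inr ⟨h3.trans h1, h2⟩

lemma strictBtw_irrefl (x₀ s : ℝ) : ¬ StrictBtw x₀ s s := by
  rintro (⟨-, h⟩ | ⟨h, -⟩) <;> exact lt_irrefl _ h

section ODE

variable {E : Type*} [NormedAddCommGroup E] [NormedSpace ℂ E] [CompleteSpace E] {r : ℂ}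
  {μ : Measure ℝ} [IsFiniteMeasure μ] {C : E} {G : ℝ → E}

lemma balPrim_eq_add (hG : Integrable G μ) (x₀ t : ℝ) :
    balPrim r μ C G t = balPrim r μ C G x₀ + (startWeight r μ x₀ t • G x₀ +
      (∫ s in {s | StrictBtw x₀ s t}, btwSign x₀ s • G s ∂μ) + endWeight r μ x₀ t • G t) := by
  rcases lt_trichotomy x₀ t with h | h | h
  · have hS : {s | StrictBtw x₀ s t} = Ioo x₀ t := by
      ext s
      simp only [StrictBtw, mem_ofPred_eq, mem_Ioo, or_iff_left_iff_imp]
      rintro ⟨h1, h2⟩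
      exact absurd (h1.trans h2) h.not_gt
    rw [hS, balPrim_sub hG h]
    simp only [startWeight, endWeight, if_pos h]
    congr 3
    refine setIntegral_congr_fun measurableSet_Ioo fun s hs => ?_
    simp [btwSign, hs.1]
  · subst h
    have hS : {s | StrictBtw x₀ s x₀} = ∅ := by
      ext s
      simp only [StrictBtw, mem_ofPred_eq, mem_empty_iff_false, iff_false]
      rintro (⟨h1, h2⟩ | ⟨h1, h2⟩) <;> exact absurd h1 h2.not_gt
    simp [hS, startWeight, endWeight]
  · have hS : {s | StrictBtw x₀ s t} = Ioo t x₀ := by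
      ext s
      simp only [StrictBtw, mem_ofPred_eq, mem_Ioo, or_iff_right_iff_imp]
      rintro ⟨h1, h2⟩
      exact absurd (h1.trans h2) h.not_gt
    have hI : ∫ s in Ioo t x₀, btwSign x₀ s • G s ∂μ = - ∫ s in Ioo t x₀, G s ∂μ := by
      rw [← integral_neg]
      refine setIntegral_congr_fun measurableSet_Ioo fun s hs => ?_
      simp [btwSign, hs.2.not_gt]
    rw [hS, hI, balPrim_sub hG h]
    simp only [startWeight, endWeight, if_neg h.not_gt, if_pos h]
    module

variable {a : ℝ → E →L[ℂ] E} {b : ℝ → E}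

/-- The resolvents `(1 - e(t) a(t))⁻¹`. -/
def endInverse (r : ℂ) (μ : Measure ℝ) (a : ℝ → E →L[ℂ] E) (x₀ t : ℝ) : E →L[ℂ] E :=
  Ring.inverse (1 - endWeight r μ x₀ t • a t)

lemma isUnit_one_sub_endWeight
    (h1 : ∀ t, IsUnit (1 - ((1 - r) * μ.real {t}) • a t))
    (h2 : ∀ t, IsUnit (1 + (r * μ.real {t}) • a t)) (x₀ t : ℝ) :
    IsUnit (1 - endWeight r μ x₀ t • a t) := by
  unfold endWeight
  split_ifs
  · exact h1 t
  · simpa [sub_eq_add_neg] using h2 t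
  · simp

lemma norm_endWeight_le (x₀ t : ℝ) :
    ‖endWeight r μ x₀ t‖ ≤ (‖1 - r‖ + ‖r‖) * μ.real {t} := by
  have h0 : 0 ≤ μ.real {t} := measureReal_nonneg
  have h1 : 0 ≤ ‖1 - r‖ * μ.real {t} := by positivity
  have h2 : 0 ≤ ‖r‖ * μ.real {t} := by positivity
  unfold endWeight
  split_ifs
  · rw [norm_mul, Complex.norm_real, Real.norm_of_nonneg h0]
    linarith
  · rw [norm_neg, norm_mul, Complex.norm_real, Real.norm_of_nonneg h0]
    linarith
  · rw [norm_zero]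
    linarith

lemma measureReal_singleton_mul_norm_le {F : Type*} [NormedAddCommGroup F] {f : ℝ → F}
    (hf : Integrable f μ) (t : ℝ) : μ.real {t} * ‖f t‖ ≤ ∫ s, ‖f s‖ ∂μ := by
  have := setIntegral_le_integral (s := {t}) hf.norm (Eventually.of_forall fun s => norm_nonneg _)
  simpa [integral_singleton, measureReal_def] using this

lemma countable_endWeight_ne_zero (x₀ : ℝ) : {t | endWeight r μ x₀ t ≠ 0}.Countable := by
  refine (countable_measure_singleton_ne_zero μ).mono fun t ht => ?_
  rw [mem_ofPred_eq] at ht ⊢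
  contrapose! ht
  simp [endWeight, ht]

lemma stronglyMeasurable_endWeight (x₀ : ℝ) : StronglyMeasurable (endWeight r μ x₀) := by
  refine StronglyMeasurable.of_countable_ne (f := fun _ => 0) stronglyMeasurable_const ?_
  simpa [eq_comm] using countable_endWeight_ne_zero (r := r) (μ := μ) x₀

lemma stronglyMeasurable_endInverse (x₀ : ℝ) : StronglyMeasurable (endInverse r μ a x₀) := by
  refine StronglyMeasurable.of_countable_ne (f := fun _ => 1) stronglyMeasurable_const ?_
  refine (countable_endWeight_ne_zero (r := r) (μ := μ) x₀).mono fun t ht => ?_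
  rw [mem_ofPred_eq] at ht ⊢
  contrapose! ht
  simp [endInverse, ht]

lemma exists_norm_endInverse_le (hai : Integrable a μ) (x₀ : ℝ) :
    ∃ B : ℝ, ∀ t, ‖endInverse r μ a x₀ t‖ ≤ B := by
  have hcont : ContinuousAt (fun x : E →L[ℂ] E => Ring.inverse (1 - x)) 0 := by
    have h1 : ContinuousAt (Ring.inverse : (E →L[ℂ] E) → _) (1 - 0) := by
      simpa using NormedRing.inverse_continuousAt (1 : (E →L[ℂ] E)ˣ)
    exact ContinuousAt.comp (f := fun x : E →L[ℂ] E => 1 - x) h1 (by fun_prop)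
  have hev : ∀ᶠ x : E →L[ℂ] E in 𝓝 0, ‖Ring.inverse (1 - x)‖ < ‖(1 : E →L[ℂ] E)‖ + 1 := by
    refine hcont.norm.eventually_lt_const ?_
    simp
  obtain ⟨ε, hε, hball⟩ := Metric.eventually_nhds_iff.1 hev
  set c := ‖1 - r‖ + ‖r‖ + 1 with hc
  have hcpos : 0 < c := by positivity
  have hfinm : IsFiniteMeasure (μ.withDensity fun s => ‖a s‖ₑ) :=
    isFiniteMeasure_withDensity hai.2.ne
  have hfin := finite_le_measure_singleton (μ.withDensity fun s => ‖a s‖ₑ)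
    (ε := ENNReal.ofReal (ε / c)) (by simp; positivity)
  obtain ⟨B, hB⟩ := (hfin.image fun t => ‖endInverse r μ a x₀ t‖).bddAbove
  refine ⟨max B (‖(1 : E →L[ℂ] E)‖ + 1), fun t => ?_⟩
  by_cases ht : ENNReal.ofReal (ε / c) ≤ (μ.withDensity fun s => ‖a s‖ₑ) {t}
  · exact (hB ⟨t, ht, rfl⟩).trans (le_max_left _ _)
  · refine le_trans (le_of_lt (hball ?_)) (le_max_right _ _)
    rw [dist_zero_right, norm_smul]
    rw [withDensity_apply _ (measurableSet_singleton t), lintegral_singleton, ← ofReal_norm,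
      ← ofReal_measureReal, ← ENNReal.ofReal_mul (norm_nonneg _),
      ENNReal.ofReal_le_ofReal_iff (by positivity), not_le, lt_div_iff₀ hcpos] at ht
    refine lt_of_le_of_lt ?_ ht
    have h1 := norm_endWeight_le (r := r) (μ := μ) x₀ t
    have h0 : 0 ≤ μ.real {t} := measureReal_nonneg
    calc ‖endWeight r μ x₀ t‖ * ‖a t‖ ≤ (c * μ.real {t}) * ‖a t‖ := by
          gcongr
          refine h1.trans ?_
          gcongr
          linarith
      _ = _ := by ring

lemma balPrim_unique (ha : StronglyMeasurable a) (hai : Integrable a μ)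
    (h1 : ∀ t, IsUnit (1 - ((1 - r) * μ.real {t}) • a t))
    (h2 : ∀ t, IsUnit (1 + (r * μ.real {t}) • a t)) (x₀ : ℝ) {y₁ y₂ : ℝ → E} {C₁ C₂ : E}
    (hi₁ : Integrable (fun s => a s (y₁ s) + b s) μ)
    (hi₂ : Integrable (fun s => a s (y₂ s) + b s) μ)
    (hy₁ : ∀ t, y₁ t = balPrim r μ C₁ (fun s => a s (y₁ s) + b s) t)
    (hy₂ : ∀ t, y₂ t = balPrim r μ C₂ (fun s => a s (y₂ s) + b s) t)
    (h0 : y₁ x₀ = y₂ x₀) : y₁ = y₂ := by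
  set z : ℝ → E := fun t => y₁ t - y₂ t with hz
  have hzi : Integrable (fun s => a s (z s)) μ := by
    refine (hi₁.sub hi₂).congr (Eventually.of_forall fun s => ?_)
    simp [hz]
  have hzp : ∀ t, z t = balPrim r μ (C₁ - C₂) (fun s => a s (z s)) t := by
    intro t
    have e : (fun s => a s (z s)) = fun s => (a s (y₁ s) + b s) - (a s (y₂ s) + b s) := by
      funext s
      simp [hz]
    rw [e, hz]
    simp only [balPrim]
    rw [integral_sub hi₁.integrableOn hi₂.integrableOn, integral_sub hi₁.integrableOn
      hi₂.integrableOn]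
    nth_rewrite 1 [hy₁ t, hy₂ t]
    simp only [balPrim]
    module
  have hz0 : z x₀ = 0 := by simp [hz, h0]
  obtain ⟨B, hB⟩ := exists_norm_endInverse_le (r := r) hai x₀
  have hB0 : 0 ≤ B := (norm_nonneg _).trans (hB 0)
  have hzM : ∀ t, z t = endInverse r μ a x₀ t
      (∫ s in {s | StrictBtw x₀ s t}, btwSign x₀ s • a s (z s) ∂μ) := by
    intro t
    have e := balPrim_eq_add (r := r) (C := C₁ - C₂) hzi x₀ t
    rw [← hzp, ← hzp, hz0, map_zero, smul_zero, zero_add, zero_add] at e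
    have e2 : (1 - endWeight r μ x₀ t • a t) (z t) =
        ∫ s in {s | StrictBtw x₀ s t}, btwSign x₀ s • a s (z s) ∂μ := by
      simp only [sub_apply, one_apply_eq_self, smul_apply]
      rw [sub_eq_iff_eq_add]
      exact e
    rw [← e2, endInverse, ← mul_apply_eq_comp,
      Ring.inverse_mul_cancel _ (isUnit_one_sub_endWeight h1 h2 x₀ t)]
    simp
  have hsign : ∀ s, ‖btwSign x₀ s‖ₑ = 1 := by
    intro s
    unfold btwSign
    split_ifs <;> simp
  have key := volterra_eq_zero (R := StrictBtw x₀) (measurableSet_strictBtw x₀)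
    (strictBtw_trans x₀) (strictBtw_irrefl x₀) (μ := μ)
    (k := fun s => ENNReal.ofReal B * ‖a s‖ₑ) (ha.enorm.const_mul _)
    (by
      rw [lintegral_const_mul _ ha.enorm]
      exact ENNReal.mul_ne_top ENNReal.ofReal_ne_top hai.2.ne)
    (w := fun t => ‖z t‖ₑ) (B := ENNReal.ofReal _) ENNReal.ofReal_ne_top
    (fun t => by
      rw [← ofReal_norm, hzp t]
      exact ENNReal.ofReal_le_ofReal (norm_balPrim_le hzi t))
    (fun t => by
      calc ‖z t‖ₑ ≤ ‖endInverse r μ a x₀ t‖ₑ *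
            ‖∫ s in {s | StrictBtw x₀ s t}, btwSign x₀ s • a s (z s) ∂μ‖ₑ := by
            nth_rewrite 1 [hzM t]
            exact ContinuousLinearMap.le_opENorm _ _
        _ ≤ ENNReal.ofReal B *
            ∫⁻ s in {s | StrictBtw x₀ s t}, ‖btwSign x₀ s • a s (z s)‖ₑ ∂μ := by
            gcongr
            · rw [← ofReal_norm]
              exact ENNReal.ofReal_le_ofReal (hB t)
            · exact enorm_integral_le_lintegral_enorm _
        _ = ∫⁻ s in {s | StrictBtw x₀ s t}, ENNReal.ofReal B * ‖btwSign x₀ s • a s (z s)‖ₑ ∂μ := by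
            rw [lintegral_const_mul' _ _ ENNReal.ofReal_ne_top]
        _ ≤ _ := by
            refine lintegral_mono fun s => ?_
            rw [enorm_smul, hsign, one_mul, mul_assoc]
            gcongr
            exact ContinuousLinearMap.le_opENorm _ _)
  funext t
  have := key t
  simpa [hz, sub_eq_zero] using this

lemma exists_balPrim (ha : StronglyMeasurable a) (hai : Integrable a μ)
    (hb : StronglyMeasurable b) (hbi : Integrable b μ)
    (h1 : ∀ t, IsUnit (1 - ((1 - r) * μ.real {t}) • a t))
    (h2 : ∀ t, IsUnit (1 + (r * μ.real {t}) • a t)) (x₀ : ℝ) (y₀ : E) :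
    ∃ (y : ℝ → E) (C : E), Integrable (fun s => a s (y s) + b s) μ ∧
      (∀ t, y t = balPrim r μ C (fun s => a s (y s) + b s) t) ∧ y x₀ = y₀ := by
  obtain ⟨B, hB⟩ := exists_norm_endInverse_le (r := r) hai x₀
  have hB0 : 0 ≤ B := (norm_nonneg _).trans (hB 0)
  set M := endInverse r μ a x₀ with hM
  set e := endWeight r μ x₀ with he
  have hMm : StronglyMeasurable M := stronglyMeasurable_endInverse x₀
  have hem : StronglyMeasurable e := stronglyMeasurable_endWeight x₀
  have hσm : StronglyMeasurable (btwSign x₀) := by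
    unfold btwSign
    exact StronglyMeasurable.ite measurableSet_Ioi stronglyMeasurable_const stronglyMeasurable_const
  have hσ : ∀ s, ‖btwSign x₀ s‖ = 1 := by
    intro s
    unfold btwSign
    split_ifs <;> simp
  have happ : ∀ {f : ℝ → E →L[ℂ] E} {g : ℝ → E}, StronglyMeasurable f → StronglyMeasurable g →
      StronglyMeasurable fun s => f s (g s) := fun hf hg =>
    isBoundedBilinearMap_apply.continuous.comp_stronglyMeasurable (hf.prodMk hg)
  have hebm : StronglyMeasurable fun s => e s • b s := hem.smul hb
  have hebb : ∀ t, ‖e t • b t‖ ≤ (‖1 - r‖ + ‖r‖) * ∫ s, ‖b s‖ ∂μ := by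
    intro t
    rw [norm_smul]
    calc ‖e t‖ * ‖b t‖ ≤ ((‖1 - r‖ + ‖r‖) * μ.real {t}) * ‖b t‖ := by
          gcongr
          exact norm_endWeight_le x₀ t
      _ = (‖1 - r‖ + ‖r‖) * (μ.real {t} * ‖b t‖) := by ring
      _ ≤ _ := by
          gcongr
          exact measureReal_singleton_mul_norm_le hbi t
  set D := (‖1 - r‖ + ‖r‖) * ∫ s, ‖b s‖ ∂μ with hD
  have hGi : ∀ {z : ℝ → E} {c : ℝ}, StronglyMeasurable z → (∀ t, ‖z t‖ ≤ c) →
      Integrable (fun s => a s (M s (z s + e s • b s)) + b s) μ := by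
    intro z c hz hc
    refine Integrable.add ?_ hbi
    refine Integrable.mono' (hai.norm.mul_const (B * (c + D)))
      (happ ha (happ hMm (hz.add hebm))).aestronglyMeasurable (Eventually.of_forall fun s => ?_)
    refine ((a s).le_opNorm _).trans ?_
    gcongr
    refine ((M s).le_opNorm _).trans ?_
    gcongr
    · exact hB s
    · exact (norm_add_le _ _).trans (add_le_add (hc s) (hebb s))
  set G₀ := a x₀ y₀ + b x₀ with hG₀
  set c₀ : ℝ → E := fun s => a s (M s (e s • b s)) + b s with hc₀
  have hc₀m : StronglyMeasurable c₀ := (happ ha (happ hMm hebm)).add hb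
  have hc₀i : Integrable c₀ μ := by
    have := hGi (z := fun _ => 0) (c := 0) stronglyMeasurable_const (by simp)
    simpa only [zero_add] using this
  have hσc₀i : Integrable (fun s => btwSign x₀ s • c₀ s) μ := by
    refine Integrable.mono hc₀i (hσm.smul hc₀m).aestronglyMeasurable
      (Eventually.of_forall fun s => ?_)
    rw [norm_smul, hσ, one_mul]
  set K : ℝ → E →L[ℂ] E := fun s => btwSign x₀ s • ((a s).comp (M s)) with hK
  have hKm : StronglyMeasurable K := hσm.smul
    (((ContinuousLinearMap.compL ℂ E E E).isBoundedBilinearMap).continuous.comp_stronglyMeasurable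
      (ha.prodMk hMm))
  have hKi : Integrable K μ := by
    refine Integrable.mono' (hai.norm.mul_const B) hKm.aestronglyMeasurable
      (Eventually.of_forall fun s => ?_)
    rw [hK]
    simp only
    rw [norm_smul, hσ, one_mul]
    refine ((a s).opNorm_comp_le _).trans ?_
    gcongr
    exact hB s
  have hstm : StronglyMeasurable (startWeight r μ x₀) := by
    unfold startWeight
    exact StronglyMeasurable.ite measurableSet_Ioi stronglyMeasurable_const
      (StronglyMeasurable.ite measurableSet_Iio stronglyMeasurable_const stronglyMeasurable_const)
  have hstb : ∀ t, ‖startWeight r μ x₀ t‖ ≤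
      ‖r * μ.real {x₀}‖ + ‖(1 - r) * μ.real {x₀}‖ := by
    intro t
    unfold startWeight
    split_ifs
    · linarith [norm_nonneg ((1 - r) * μ.real {x₀})]
    · rw [norm_neg]
      linarith [norm_nonneg (r * μ.real {x₀})]
    · rw [norm_zero]
      positivity
  set g : ℝ → E := fun t => y₀ + startWeight r μ x₀ t • G₀ +
    ∫ s in {s | StrictBtw x₀ s t}, btwSign x₀ s • c₀ s ∂μ with hg
  have hgm : StronglyMeasurable g :=
    (stronglyMeasurable_const.add (hstm.smul stronglyMeasurable_const)).add
      (stronglyMeasurable_setIntegral_rel (measurableSet_strictBtw x₀) (hσm.smul hc₀m))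
  obtain ⟨z, hzm, ⟨c, hzc⟩, hz⟩ := exists_volterra (measurableSet_strictBtw x₀)
    (strictBtw_trans x₀) (strictBtw_irrefl x₀) (μ := μ) hKm hKi hgm
    (C := ‖y₀‖ + (‖r * μ.real {x₀}‖ + ‖(1 - r) * μ.real {x₀}‖) * ‖G₀‖ +
      ∫ s, ‖btwSign x₀ s • c₀ s‖ ∂μ) (by
      intro t
      refine (norm_add_le _ _).trans (add_le_add ((norm_add_le _ _).trans (add_le_add le_rfl ?_)) ?_)
      · rw [norm_smul]
        gcongr
        exact hstb t
      · exact (norm_integral_le_integral_norm _).trans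
          (setIntegral_le_integral hσc₀i.norm (Eventually.of_forall fun s => norm_nonneg _)))
  set y : ℝ → E := fun t => M t (z t + e t • b t) with hy
  set G : ℝ → E := fun s => a s (y s) + b s with hG
  have hGint : Integrable G μ := hGi hzm hzc
  have hyz : ∀ t, y t = z t + e t • G t := by
    intro t
    have h3 : (1 - e t • a t) (y t) = z t + e t • b t := by
      rw [hy]
      simp only
      rw [hM, endInverse, ← mul_apply_eq_comp,
        Ring.mul_inverse_cancel _ (isUnit_one_sub_endWeight h1 h2 x₀ t)]
      simp
    simp only [sub_apply, one_apply_eq_self, smul_apply] at h3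
    rw [sub_eq_iff_eq_add] at h3
    rw [h3, hG]
    simp only
    module
  have hz' : ∀ t, z t = y₀ + startWeight r μ x₀ t • G₀ +
      ∫ s in {s | StrictBtw x₀ s t}, btwSign x₀ s • G s ∂μ := by
    intro t
    rw [hz t, hg]
    simp only
    rw [add_assoc, ← integral_add hσc₀i.integrableOn]
    · congr 2
      funext s
      simp only [hc₀, hK, hG, hy, smul_apply, ContinuousLinearMap.comp_apply, map_add]
      module
    · refine Integrable.integrableOn ?_
      refine Integrable.mono' (hKi.norm.mul_const c) (happ hKm hzm).aestronglyMeasurable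
        (Eventually.of_forall fun s => ((K s).le_opNorm _).trans ?_)
      gcongr
      exact hzc s
  have hirr : {s | StrictBtw x₀ s x₀} = ∅ := by
    ext s
    simp only [StrictBtw, mem_ofPred_eq, mem_empty_iff_false, iff_false]
    rintro (⟨h1, h2⟩ | ⟨h1, h2⟩) <;> exact absurd h1 h2.not_gt
  have hyx : y x₀ = y₀ := by
    rw [hyz, hz' x₀, hirr]
    simp [startWeight, he, endWeight]
  have hGx : G x₀ = G₀ := by
    simp only [hG, hyx, hG₀]
  refine ⟨y, y₀ - r • (∫ s in Iio x₀, G s ∂μ) - (1 - r) • ∫ s in Iic x₀, G s ∂μ, hGint,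
    fun t => ?_, hyx⟩
  rw [balPrim_eq_add hGint x₀ t, hyz, hz', hGx]
  simp only [balPrim]
  module

end ODE

lemma setIntegral_Iic_sub {F : Type*} [NormedAddCommGroup F] [NormedSpace ℝ F] {μ : Measure ℝ}
    {G : ℝ → F} (hG : Integrable G μ) {x t : ℝ} (h : x ≤ t) :
    (∫ s in Iic t, G s ∂μ) - ∫ s in Iic x, G s ∂μ = ∫ s in Ioc x t, G s ∂μ := by
  rw [← Iic_union_Ioc_eq_Iic h, setIntegral_union _ measurableSet_Ioc hG.integrableOn
    hG.integrableOn]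
  · simp
  · rw [Set.disjoint_left]
    intro s hs hs2
    exact absurd hs2.1 (not_lt.2 hs)

lemma setIntegral_Iio_sub {F : Type*} [NormedAddCommGroup F] [NormedSpace ℝ F] {μ : Measure ℝ}
    {G : ℝ → F} (hG : Integrable G μ) {x t : ℝ} (h : x ≤ t) :
    (∫ s in Iio t, G s ∂μ) - ∫ s in Iio x, G s ∂μ = ∫ s in Ico x t, G s ∂μ := by
  rw [← Iio_union_Ico_eq_Iio h, setIntegral_union _ measurableSet_Ico hG.integrableOn
    hG.integrableOn]
  · simp
  · rw [Set.disjoint_left]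
    intro s hs hs2
    exact absurd hs2.1 (not_le.2 hs)

section Primitive

variable {E : Type*} [NormedAddCommGroup E] [NormedSpace ℂ E] {r : ℂ} {μ : Measure ℝ}
  {C : E} {G : ℝ → E}

lemma tendsto_setIntegral_Iic_left (hG : Integrable G μ) (x : ℝ) :
    Tendsto (fun t => ∫ s in Iic t, G s ∂μ) (𝓝[<] x) (𝓝 (∫ s in Iio x, G s ∂μ)) := by
  simp_rw [← integral_indicator measurableSet_Iic, ← integral_indicator measurableSet_Iio]
  refine tendsto_integral_filter_of_dominated_convergence (fun s => ‖G s‖)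
    (Eventually.of_forall fun t => hG.aestronglyMeasurable.indicator measurableSet_Iic)
    (Eventually.of_forall fun t => Eventually.of_forall fun s => norm_indicator_le_norm_self _ _)
    hG.norm (Eventually.of_forall fun s => tendsto_const_nhds.congr' ?_)
  rcases lt_or_ge s x with h | h
  · filter_upwards [mem_nhdsWithin_of_mem_nhds (Ioi_mem_nhds h)] with t ht
    rw [indicator_of_mem (mem_Iio.2 h), indicator_of_mem (mem_Iic.2 (le_of_lt ht))]
  · filter_upwards [self_mem_nhdsWithin] with t ht
    rw [indicator_of_notMem (notMem_Iio.2 h), indicator_of_notMem]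
    exact not_le.2 (lt_of_lt_of_le ht h)

lemma tendsto_setIntegral_Iio_left (hG : Integrable G μ) (x : ℝ) :
    Tendsto (fun t => ∫ s in Iio t, G s ∂μ) (𝓝[<] x) (𝓝 (∫ s in Iio x, G s ∂μ)) := by
  simp_rw [← integral_indicator measurableSet_Iio]
  refine tendsto_integral_filter_of_dominated_convergence (fun s => ‖G s‖)
    (Eventually.of_forall fun t => hG.aestronglyMeasurable.indicator measurableSet_Iio)
    (Eventually.of_forall fun t => Eventually.of_forall fun s => norm_indicator_le_norm_self _ _)
    hG.norm (Eventually.of_forall fun s => tendsto_const_nhds.congr' ?_)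
  rcases lt_or_ge s x with h | h
  · filter_upwards [mem_nhdsWithin_of_mem_nhds (Ioi_mem_nhds h)] with t ht
    rw [indicator_of_mem (mem_Iio.2 h), indicator_of_mem (mem_Iio.2 ht)]
  · filter_upwards [self_mem_nhdsWithin] with t ht
    rw [indicator_of_notMem (notMem_Iio.2 h), indicator_of_notMem]
    exact not_lt.2 (le_of_lt (lt_of_lt_of_le ht h))

lemma tendsto_setIntegral_Iic_right (hG : Integrable G μ) (x : ℝ) :
    Tendsto (fun t => ∫ s in Iic t, G s ∂μ) (𝓝[>] x) (𝓝 (∫ s in Iic x, G s ∂μ)) := by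
  simp_rw [← integral_indicator measurableSet_Iic]
  refine tendsto_integral_filter_of_dominated_convergence (fun s => ‖G s‖)
    (Eventually.of_forall fun t => hG.aestronglyMeasurable.indicator measurableSet_Iic)
    (Eventually.of_forall fun t => Eventually.of_forall fun s => norm_indicator_le_norm_self _ _)
    hG.norm (Eventually.of_forall fun s => tendsto_const_nhds.congr' ?_)
  rcases lt_or_ge x s with h | h
  · filter_upwards [mem_nhdsWithin_of_mem_nhds (Iio_mem_nhds h)] with t ht
    rw [indicator_of_notMem (notMem_Iic.2 h), indicator_of_notMem (notMem_Iic.2 ht)]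
  · filter_upwards [self_mem_nhdsWithin] with t ht
    rw [indicator_of_mem (mem_Iic.2 h), indicator_of_mem]
    exact h.trans (le_of_lt ht)

lemma tendsto_setIntegral_Iio_right (hG : Integrable G μ) (x : ℝ) :
    Tendsto (fun t => ∫ s in Iio t, G s ∂μ) (𝓝[>] x) (𝓝 (∫ s in Iic x, G s ∂μ)) := by
  simp_rw [← integral_indicator measurableSet_Iic, ← integral_indicator measurableSet_Iio]
  refine tendsto_integral_filter_of_dominated_convergence (fun s => ‖G s‖)
    (Eventually.of_forall fun t => hG.aestronglyMeasurable.indicator measurableSet_Iio)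
    (Eventually.of_forall fun t => Eventually.of_forall fun s => norm_indicator_le_norm_self _ _)
    hG.norm (Eventually.of_forall fun s => tendsto_const_nhds.congr' ?_)
  rcases lt_or_ge x s with h | h
  · filter_upwards [mem_nhdsWithin_of_mem_nhds (Iio_mem_nhds h)] with t ht
    rw [indicator_of_notMem (notMem_Iic.2 h), indicator_of_notMem]
    exact not_lt.2 (le_of_lt (mem_Iio.1 ht))
  · filter_upwards [self_mem_nhdsWithin] with t ht
    rw [indicator_of_mem (mem_Iic.2 h), indicator_of_mem]
    exact lt_of_le_of_lt h ht

lemma leftLim_balPrim (hG : Integrable G μ) (x : ℝ) :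
    leftLim (balPrim r μ C G) x = C + ∫ s in Iio x, G s ∂μ := by
  refine leftLim_eq_of_tendsto ?_
  have h := (tendsto_const_nhds (x := C)).add ((tendsto_setIntegral_Iio_left hG x).const_smul r)
  have h2 := h.add ((tendsto_setIntegral_Iic_left hG x).const_smul (1 - r))
  have e : C + ∫ s in Iio x, G s ∂μ = C + r • (∫ s in Iio x, G s ∂μ) +
      (1 - r) • ∫ s in Iio x, G s ∂μ := by module
  rw [e]
  exact h2

lemma rightLim_balPrim (hG : Integrable G μ) (x : ℝ) :
    rightLim (balPrim r μ C G) x = C + ∫ s in Iic x, G s ∂μ := by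
  refine rightLim_eq_of_tendsto ?_
  have h := (tendsto_const_nhds (x := C)).add ((tendsto_setIntegral_Iio_right hG x).const_smul r)
  have h2 := h.add ((tendsto_setIntegral_Iic_right hG x).const_smul (1 - r))
  have e : C + ∫ s in Iic x, G s ∂μ = C + r • (∫ s in Iic x, G s ∂μ) +
      (1 - r) • ∫ s in Iic x, G s ∂μ := by module
  rw [e]
  exact h2

lemma locallyBoundedVariationOn_of_edist_le {F : Type*} [PseudoEMetricSpace F] {f : ℝ → F}
    {v : ℝ → ℝ} (hv : Monotone v) (h : ∀ x t, x ≤ t → edist (f t) (f x) ≤ edist (v t) (v x))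
    (S : Set ℝ) : LocallyBoundedVariationOn f S := by
  intro x y hx hy
  refine ne_top_of_le_ne_top ((hv.monotoneOn S).locallyBoundedVariationOn x y hx hy) ?_
  refine iSup_mono fun p => Finset.sum_le_sum fun i _ => ?_
  exact h _ _ (p.2.2.1 (Nat.le_succ i))

lemma locallyBoundedVariationOn_balPrim (hG : Integrable G μ) (S : Set ℝ) :
    LocallyBoundedVariationOn (balPrim r μ C G) S := by
  refine locallyBoundedVariationOn_of_edist_le (v := fun t =>
    ‖r‖ * (∫ s in Iio t, ‖G s‖ ∂μ) + ‖1 - r‖ * ∫ s in Iic t, ‖G s‖ ∂μ) ?_ ?_ S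
  · intro x t h
    simp only
    gcongr ?_ * ?_ + ?_ * ?_
    · rw [← sub_nonneg, setIntegral_Iio_sub hG.norm h]
      exact integral_nonneg fun s => norm_nonneg _
    · rw [← sub_nonneg, setIntegral_Iic_sub hG.norm h]
      exact integral_nonneg fun s => norm_nonneg _
  · intro x t h
    have e1 : balPrim r μ C G t - balPrim r μ C G x =
        r • (∫ s in Ico x t, G s ∂μ) + (1 - r) • ∫ s in Ioc x t, G s ∂μ := by
      rw [← setIntegral_Iio_sub hG h, ← setIntegral_Iic_sub hG h]
      simp only [balPrim]
      module
    have e2 : (‖r‖ * (∫ s in Iio t, ‖G s‖ ∂μ) + ‖1 - r‖ * ∫ s in Iic t, ‖G s‖ ∂μ) -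
        (‖r‖ * (∫ s in Iio x, ‖G s‖ ∂μ) + ‖1 - r‖ * ∫ s in Iic x, ‖G s‖ ∂μ) =
        ‖r‖ * (∫ s in Ico x t, ‖G s‖ ∂μ) + ‖1 - r‖ * ∫ s in Ioc x t, ‖G s‖ ∂μ := by
      rw [← setIntegral_Iio_sub hG.norm h, ← setIntegral_Iic_sub hG.norm h]
      ring
    rw [edist_dist, edist_dist]
    refine ENNReal.ofReal_le_ofReal ?_
    rw [dist_eq_norm, Real.dist_eq, e1, e2]
    refine le_trans ?_ (le_abs_self _)
    refine (norm_add_le _ _).trans (add_le_add ?_ ?_) <;> rw [norm_smul] <;> gcongr <;>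
      exact norm_integral_le_integral_norm _

end Primitive

lemma leftLim_congr {F : Type*} [TopologicalSpace F] [T2Space F] {f g : ℝ → F} {x : ℝ}
    (h : f =ᶠ[𝓝 x] g) : leftLim f x = leftLim g x := by
  have h' : f =ᶠ[𝓝[<] x] g := h.filter_mono nhdsWithin_le_nhds
  by_cases hf : ∃ y, Tendsto f (𝓝[<] x) (𝓝 y)
  · obtain ⟨y, hy⟩ := hf
    rw [leftLim_eq_of_tendsto hy, leftLim_eq_of_tendsto (hy.congr' h')]
  · rw [leftLim_eq_of_not_tendsto f hf, leftLim_eq_of_not_tendsto g, h.self_of_nhds]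
    rintro ⟨y, hy⟩
    exact hf ⟨y, hy.congr' h'.symm⟩

lemma rightLim_congr {F : Type*} [TopologicalSpace F] [T2Space F] {f g : ℝ → F} {x : ℝ}
    (h : f =ᶠ[𝓝 x] g) : rightLim f x = rightLim g x := by
  have h' : f =ᶠ[𝓝[>] x] g := h.filter_mono nhdsWithin_le_nhds
  by_cases hf : ∃ y, Tendsto f (𝓝[>] x) (𝓝 y)
  · obtain ⟨y, hy⟩ := hf
    rw [rightLim_eq_of_tendsto hy, rightLim_eq_of_tendsto (hy.congr' h')]
  · rw [rightLim_eq_of_not_tendsto f hf, rightLim_eq_of_not_tendsto g, h.self_of_nhds]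
    rintro ⟨y, hy⟩
    exact hf ⟨y, hy.congr' h'.symm⟩

section LocBV

variable {I : Set ℝ} {c d : ℝ}

lemma exists_boundedVariation_extension {F : Type*} [PseudoEMetricSpace F] {f : ℝ → F}
    (hI : IsOpen I) (hf : LocallyBoundedVariationOn f I) (hc : c ∈ I) (hd : d ∈ I)
    (hcd : c ≤ d) (hsub : I.OrdConnected) : ∃ (g : ℝ → F) (c' d' : ℝ),
      BoundedVariationOn g univ ∧ c' < c ∧ d < d' ∧ Icc c' d' ⊆ I ∧ EqOn g f (Icc c' d') := by
  obtain ⟨ε, hε, hball⟩ := Metric.isOpen_iff.1 hI c hc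
  obtain ⟨δ, hδ, hball'⟩ := Metric.isOpen_iff.1 hI d hd
  have hc' : c - ε / 2 ∈ I := hball (by simp [abs_of_pos hε]; linarith)
  have hd' : d + δ / 2 ∈ I := hball' (by simp [abs_of_pos hδ]; linarith)
  have hle : c - ε / 2 ≤ d + δ / 2 := by linarith
  refine ⟨fun x => f (projIcc _ _ hle x), c - ε / 2, d + δ / 2, ?_, by linarith, by linarith,
    hsub.out hc' hd', fun x hx => ?_⟩
  · refine ne_top_of_le_ne_top (hf _ _ hc' hd') ?_
    refine eVariationOn.comp_le_of_monotoneOn f (fun x => (projIcc _ _ hle x : ℝ)) ?_ ?_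
    · intro x _ y _ hxy
      exact monotone_projIcc hle hxy
    · intro x _
      exact ⟨hsub.out hc' hd' (projIcc _ _ hle x).2, (projIcc _ _ hle x).2⟩
  · simp only
    rw [projIcc_of_mem hle hx]

lemma tendsto_leftLim_of_locBV {F : Type*} [PseudoEMetricSpace F] [CompleteSpace F]
    {f : ℝ → F}
    (hI : IsOpen I) (ho : I.OrdConnected) (hf : LocallyBoundedVariationOn f I) {x : ℝ}
    (hx : x ∈ I) : Tendsto f (𝓝[<] x) (𝓝 (leftLim f x)) := by
  obtain ⟨g, c', d', hg, h1, h2, -, h3⟩ :=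
    exists_boundedVariation_extension hI hf hx hx le_rfl ho
  have he : g =ᶠ[𝓝 x] f := h3.eventuallyEq_of_mem (Icc_mem_nhds h1 h2)
  exact tendsto_leftLim_of_tendsto
    ⟨_, (hg.tendsto_leftLim x).congr' (he.filter_mono nhdsWithin_le_nhds)⟩

lemma tendsto_rightLim_of_locBV {F : Type*} [PseudoEMetricSpace F] [CompleteSpace F]
    {f : ℝ → F}
    (hI : IsOpen I) (ho : I.OrdConnected) (hf : LocallyBoundedVariationOn f I) {x : ℝ}
    (hx : x ∈ I) : Tendsto f (𝓝[>] x) (𝓝 (rightLim f x)) := by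
  obtain ⟨g, c', d', hg, h1, h2, -, h3⟩ :=
    exists_boundedVariation_extension hI hf hx hx le_rfl ho
  have he : g =ᶠ[𝓝 x] f := h3.eventuallyEq_of_mem (Icc_mem_nhds h1 h2)
  exact tendsto_rightLim_of_tendsto
    ⟨_, (hg.tendsto_rightLim x).congr' (he.filter_mono nhdsWithin_le_nhds)⟩

lemma exists_sMRepresents {f : ℝ → ℝ} (hI : IsOpen I) (ho : I.OrdConnected)
    (hf : LocallyBoundedVariationOn f I) (hc : c ∈ I) (hd : d ∈ I) (hcd : c ≤ d) :
    ∃ ν : SignedMeasure ℝ, SMRepresents ν f c d := by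
  obtain ⟨g, c', d', hg, h1, h2, -, h3⟩ :=
    exists_boundedVariation_extension hI hf hc hd hcd ho
  have he : ∀ x ∈ Icc c d, rightLim g x = rightLim f x := fun x hx =>
    rightLim_congr (h3.eventuallyEq_of_mem
      (Icc_mem_nhds (h1.trans_le hx.1) (hx.2.trans_lt h2)))
  exact ⟨hg.vectorMeasure, fun x hx y hy hxy => by
    rw [hg.vectorMeasure_Ioc hxy, he x hx, he y hy]⟩

/-- `ρ dμ` coincides on `[c,d]` with the Lebesgue–Stieltjes measure generated by `f`. -/
def DensityRep {F : Type*} [NormedAddCommGroup F] [NormedSpace ℝ F] (μ : Measure ℝ)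
    (ρ f : ℝ → F) (c d : ℝ) : Prop :=
  ∀ x ∈ Icc c d, ∀ y ∈ Icc c d, x ≤ y → rightLim f y - rightLim f x = ∫ s in Ioc x y, ρ s ∂μ

lemma rightLim_re {f : ℝ → ℂ} {x : ℝ} (hf : Tendsto f (𝓝[>] x) (𝓝 (rightLim f x))) :
    rightLim (fun t => (f t).re) x = (rightLim f x).re :=
  rightLim_eq_of_tendsto ((Complex.continuous_re.tendsto _).comp hf)

lemma rightLim_im {f : ℝ → ℂ} {x : ℝ} (hf : Tendsto f (𝓝[>] x) (𝓝 (rightLim f x))) :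
    rightLim (fun t => (f t).im) x = (rightLim f x).im :=
  rightLim_eq_of_tendsto ((Complex.continuous_im.tendsto _).comp hf)

lemma locBV_re {f : ℝ → ℂ} (hf : LocallyBoundedVariationOn f I) :
    LocallyBoundedVariationOn (fun t => (f t).re) I :=
  (Complex.reCLM.lipschitz).comp_locallyBoundedVariationOn hf

lemma locBV_im {f : ℝ → ℂ} (hf : LocallyBoundedVariationOn f I) :
    LocallyBoundedVariationOn (fun t => (f t).im) I :=
  (Complex.imCLM.lipschitz).comp_locallyBoundedVariationOn hf

lemma setIntegral_rnDeriv_eq {μ : Measure ℝ} [IsFiniteMeasure μ] {ν : SignedMeasure ℝ}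
    (h : ν.totalVariation ≪ μ) {S : Set ℝ} (hS : MeasurableSet S) :
    ∫ s in S, ν.rnDeriv μ s ∂μ = ν S := by
  have h1 : ν ≪ᵥ μ.toENNRealVectorMeasure :=
    (SignedMeasure.absolutelyContinuous_ennreal_iff _ _).2 (by simpa using h)
  have h2 := SignedMeasure.withDensityᵥ_rnDeriv_eq ν μ h1
  conv_rhs => rw [← h2]
  rw [withDensityᵥ_apply (SignedMeasure.integrable_rnDeriv ν μ) hS]

lemma exists_densityRep {ι : Type*} [Fintype ι] {f : ι → ℝ → ℂ} (hI : IsOpen I)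
    (ho : I.OrdConnected) (hf : ∀ k, LocallyBoundedVariationOn (f k) I) (hc : c ∈ I) (hd : d ∈ I)
    (hcd : c ≤ d) : ∃ (μ : Measure ℝ) (ρ : ι → ℝ → ℂ), IsFiniteMeasure μ ∧
      (∀ k, Measurable (ρ k)) ∧ (∀ k, Integrable (ρ k) μ) ∧
      ∀ k, DensityRep μ (ρ k) (f k) c d := by
  choose ν hν using fun k => exists_sMRepresents hI ho (locBV_re (hf k)) hc hd hcd
  choose η hη using fun k => exists_sMRepresents hI ho (locBV_im (hf k)) hc hd hcd
  set μ : Measure ℝ := ∑ k, ((ν k).totalVariation + (η k).totalVariation) with hμ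
  have hfin : IsFiniteMeasure μ := by
    rw [hμ]
    infer_instance
  have hle : ∀ k, (ν k).totalVariation + (η k).totalVariation ≤ μ := fun k =>
    Finset.single_le_sum (f := fun k => (ν k).totalVariation + (η k).totalVariation)
      (fun _ _ => Measure.zero_le _) (Finset.mem_univ k)
  have hνμ : ∀ k, (ν k).totalVariation ≪ μ := fun k =>
    Measure.absolutelyContinuous_of_le (le_trans (Measure.le_add_right le_rfl) (hle k))
  have hημ : ∀ k, (η k).totalVariation ≪ μ := fun k =>
    Measure.absolutelyContinuous_of_le (le_trans (Measure.le_add_left le_rfl) (hle k))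
  have hi1 : ∀ k, Integrable (fun s => (((ν k).rnDeriv μ s : ℝ) : ℂ)) μ := fun k =>
    (SignedMeasure.integrable_rnDeriv (ν k) μ).ofReal
  have hi2 : ∀ k, Integrable (fun s => (((η k).rnDeriv μ s : ℝ) : ℂ) * Complex.I) μ := fun k =>
    (SignedMeasure.integrable_rnDeriv (η k) μ).ofReal.mul_const _
  refine ⟨μ, fun k s => (ν k).rnDeriv μ s + (η k).rnDeriv μ s * Complex.I, hfin, fun k => ?_,
    fun k => (hi1 k).add (hi2 k), fun k x hx y hy hxy => ?_⟩
  · have h1 := SignedMeasure.measurable_rnDeriv (ν k) μ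
    have h2 := SignedMeasure.measurable_rnDeriv (η k) μ
    fun_prop
  · rw [integral_add (hi1 k).integrableOn (hi2 k).integrableOn, integral_mul_const,
      integral_complex_ofReal, integral_complex_ofReal,
      setIntegral_rnDeriv_eq (hνμ k) measurableSet_Ioc,
      setIntegral_rnDeriv_eq (hημ k) measurableSet_Ioc, hν k x hx y hy hxy, hη k x hx y hy hxy]
    have ht : ∀ z ∈ Icc c d, Tendsto (f k) (𝓝[>] z) (𝓝 (rightLim (f k) z)) := fun z hz =>
      tendsto_rightLim_of_locBV hI ho (hf k) (ho.out hc hd hz)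
    rw [rightLim_re (ht x hx), rightLim_re (ht y hy), rightLim_im (ht x hx), rightLim_im (ht y hy)]
    apply Complex.ext <;> simp

end LocBV

section SignedIntegral

variable {μ : Measure ℝ} {ρ h : ℝ → ℝ}

lemma integral_eq_of_real_eq {κ : Measure ℝ} [IsFiniteMeasure κ] (hρ : Measurable ρ)
    (hi : Integrable ρ μ) (hκ : ∀ A, MeasurableSet A → κ.real A = ∫ s in A, ρ s ∂μ) :
    ∫ s, h s ∂κ = ∫ s, ρ s * h s ∂μ := by
  have h0 : 0 ≤ᵐ[μ] ρ := ae_nonneg_of_forall_setIntegral_nonneg hi fun A hA _ => by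
    rw [← hκ A hA]
    exact measureReal_nonneg
  have e : κ = μ.withDensity fun s => ENNReal.ofReal (ρ s) := by
    ext A hA
    rw [withDensity_apply _ hA, ← ofReal_integral_eq_lintegral_ofReal hi.integrableOn
      (ae_restrict_of_ae h0), ← hκ A hA]
    simp
  rw [e, integral_withDensity_eq_integral_toReal_smul hρ.ennreal_ofReal
    (Eventually.of_forall fun s => ENNReal.ofReal_lt_top)]
  refine integral_congr_ae ?_
  filter_upwards [h0] with s hs
  rw [ENNReal.toReal_ofReal hs, smul_eq_mul]

lemma sInt_eq_setIntegral {ν : SignedMeasure ℝ} {E : Set ℝ} (hE : MeasurableSet E)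
    (hρ : Measurable ρ) (hi : IntegrableOn ρ E μ)
    (hν : ∀ A ⊆ E, MeasurableSet A → ν A = ∫ s in A, ρ s ∂μ)
    (hh : IntegrableOn (fun s => ρ s * h s) E μ) :
    sInt ν h E = ∫ s in E, ρ s * h s ∂μ := by
  obtain ⟨i, hi1, hi2, hi3, hp, hn⟩ := ν.toJordanDecomposition_spec
  have key1 : ∫ s in E, h s ∂ν.toJordanDecomposition.posPart =
      ∫ s in E, i.indicator ρ s * h s ∂μ := by
    refine integral_eq_of_real_eq (hρ.indicator hi1) (hi.indicator hi1) fun A hA => ?_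
    rw [measureReal_restrict_apply hA, hp, SignedMeasure.toMeasureOfZeroLE_real_apply _ _ _
      (hA.inter hE), Measure.restrict_restrict hA, setIntegral_indicator hi1, inter_comm i]
    exact hν _ (fun s hs => hs.1.2) ((hA.inter hE).inter hi1)
  have key2 : ∫ s in E, h s ∂ν.toJordanDecomposition.negPart =
      ∫ s in E, -iᶜ.indicator ρ s * h s ∂μ := by
    refine integral_eq_of_real_eq (hρ.indicator hi1.compl).neg
      (Integrable.neg (hi.indicator hi1.compl)) fun A hA => ?_
    rw [measureReal_restrict_apply hA, hn, SignedMeasure.toMeasureOfLEZero_real_apply _ _ _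
      (hA.inter hE), Measure.restrict_restrict hA, integral_neg,
      setIntegral_indicator hi1.compl, inter_comm iᶜ]
    rw [hν _ (fun s hs => hs.1.2) ((hA.inter hE).inter hi1.compl)]
  have j1 : Integrable (fun s => i.indicator ρ s * h s) (μ.restrict E) := by
    refine (Integrable.indicator hh hi1).congr (Eventually.of_forall fun s => ?_)
    by_cases hs : s ∈ i <;> simp [hs]
  have j2 : Integrable (fun s => iᶜ.indicator ρ s * h s) (μ.restrict E) := by
    refine (Integrable.indicator hh hi1.compl).congr (Eventually.of_forall fun s => ?_)
    by_cases hs : s ∈ i <;> simp [hs]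
  rw [sInt, key1, key2]
  simp_rw [neg_mul]
  rw [integral_neg, sub_neg_eq_add, ← integral_add j1 j2]
  refine integral_congr_ae (Eventually.of_forall fun s => ?_)
  simp only
  rw [← add_mul, ← Pi.add_apply (i.indicator ρ), indicator_self_add_compl]

lemma signedMeasure_eq_setIntegral {ν : SignedMeasure ℝ} {c d : ℝ} (hcd : c ≤ d)
    (hi : IntegrableOn ρ (Ioc c d) μ)
    (hν : ∀ x ∈ Icc c d, ∀ y ∈ Icc c d, x ≤ y → ν (Ioc x y) = ∫ s in Ioc x y, ρ s ∂μ)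
    {A : Set ℝ} (hAs : A ⊆ Ioc c d) (hA : MeasurableSet A) : ν A = ∫ s in A, ρ s ∂μ := by
  have e : ν.restrict (Ioc c d) = (μ.restrict (Ioc c d)).withDensityᵥ ρ := by
    refine VectorMeasure.ext_of_generateFrom {S | ∃ l u, l < u ∧ Ioc l u = S} ?_
      (borel_eq_generateFrom_Ioc ℝ ▸ BorelSpace.measurable_eq) (isPiSystem_Ioc id id) ?_
    · rintro S ⟨l, u, hlu, rfl⟩
      rw [VectorMeasure.restrict_apply _ measurableSet_Ioc measurableSet_Ioc,
        withDensityᵥ_apply hi measurableSet_Ioc, Measure.restrict_restrict measurableSet_Ioc,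
        Ioc_inter_Ioc]
      rcases le_total (l ⊔ c) (u ⊓ d) with h1 | h1
      · exact hν _ ⟨le_sup_right, h1.trans inf_le_right⟩ _ ⟨le_sup_right.trans h1, inf_le_right⟩ h1
      · rw [Ioc_eq_empty (not_lt.2 h1)]
        simp
    · rw [VectorMeasure.restrict_apply _ measurableSet_Ioc MeasurableSet.univ,
        withDensityᵥ_apply hi MeasurableSet.univ, Measure.restrict_univ, univ_inter]
      exact hν _ ⟨le_rfl, hcd⟩ _ ⟨hcd, le_rfl⟩ hcd
  have e2 := congrArg (fun v : SignedMeasure ℝ => v A) e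
  rwa [VectorMeasure.restrict_apply _ measurableSet_Ioc hA, withDensityᵥ_apply hi hA,
    Measure.restrict_restrict hA, inter_eq_left.2 hAs] at e2

end SignedIntegral

section Translation

variable {I : Set ℝ} {c d : ℝ} {μ : Measure ℝ}

lemma integrableOn_mul_of_locBV {ρ h : ℝ → ℝ} (ho : I.OrdConnected)
    (hh : LocallyBoundedVariationOn h I) (hc : c ∈ I) (hd : d ∈ I)
    (hρ : IntegrableOn ρ (Ioc c d) μ) : IntegrableOn (fun s => ρ s * h s) (Ioc c d) μ := by
  rcases lt_or_ge d c with hcd | hcd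
  · simp [Ioc_eq_empty (not_lt.2 hcd.le)]
  have hs : Icc c d ⊆ I := ho.out hc hd
  have hm : AEStronglyMeasurable h (μ.restrict (Ioc c d)) := by
    obtain ⟨p, q, hp, hq, e⟩ := hh.exists_monotoneOn_sub_monotoneOn
    have hs' : Ioc c d ⊆ I := Ioc_subset_Icc_self.trans hs
    have h1 := (aemeasurable_restrict_of_monotoneOn (μ := μ) measurableSet_Ioc (hp.mono hs')).sub
      (aemeasurable_restrict_of_monotoneOn measurableSet_Ioc (hq.mono hs'))
    rw [e]
    exact h1.aestronglyMeasurable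
  refine Integrable.mul_bdd (c := |h c| + (eVariationOn h (I ∩ Icc c d)).toReal) hρ hm ?_
  rw [ae_restrict_iff' measurableSet_Ioc]
  refine Eventually.of_forall fun x hx => ?_
  have h1 : edist (h x) (h c) ≤ eVariationOn h (I ∩ Icc c d) :=
    eVariationOn.edist_le h ⟨hs (Ioc_subset_Icc_self hx), Ioc_subset_Icc_self hx⟩
      ⟨hc, le_rfl, hcd⟩
  have h2 := ENNReal.toReal_mono (hh c d hc hd) h1
  rw [edist_dist, ENNReal.toReal_ofReal dist_nonneg, Real.dist_eq] at h2
  have h3 := abs_add_le (h c) (h x - h c)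
  rw [add_sub_cancel] at h3
  rw [Real.norm_eq_abs]
  linarith

lemma DensityRep.re {ρ f : ℝ → ℂ} (h : DensityRep μ ρ f c d) (hI : IsOpen I)
    (ho : I.OrdConnected) (hf : LocallyBoundedVariationOn f I) (hc : c ∈ I) (hd : d ∈ I)
    (hρ : IntegrableOn ρ (Ioc c d) μ) :
    DensityRep μ (fun s => (ρ s).re) (fun t => (f t).re) c d := by
  intro x hx y hy hxy
  have ht : ∀ z ∈ Icc c d, Tendsto f (𝓝[>] z) (𝓝 (rightLim f z)) := fun z hz =>
    tendsto_rightLim_of_locBV hI ho hf (ho.out hc hd hz)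
  rw [rightLim_re (ht x hx), rightLim_re (ht y hy), ← Complex.sub_re, h x hx y hy hxy]
  exact (integral_re (hρ.mono_set (Ioc_subset_Ioc hx.1 hy.2))).symm

lemma DensityRep.im {ρ f : ℝ → ℂ} (h : DensityRep μ ρ f c d) (hI : IsOpen I)
    (ho : I.OrdConnected) (hf : LocallyBoundedVariationOn f I) (hc : c ∈ I) (hd : d ∈ I)
    (hρ : IntegrableOn ρ (Ioc c d) μ) :
    DensityRep μ (fun s => (ρ s).im) (fun t => (f t).im) c d := by
  intro x hx y hy hxy
  have ht : ∀ z ∈ Icc c d, Tendsto f (𝓝[>] z) (𝓝 (rightLim f z)) := fun z hz =>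
    tendsto_rightLim_of_locBV hI ho hf (ho.out hc hd hz)
  rw [rightLim_im (ht x hx), rightLim_im (ht y hy), ← Complex.sub_im, h x hx y hy hxy]
  exact (integral_im (hρ.mono_set (Ioc_subset_Ioc hx.1 hy.2))).symm

lemma DensityRep.of_re_im {ρ f : ℝ → ℂ} (hI : IsOpen I)
    (ho : I.OrdConnected) (hf : LocallyBoundedVariationOn f I) (hc : c ∈ I) (hd : d ∈ I)
    (hρ : IntegrableOn ρ (Ioc c d) μ)
    (h1 : DensityRep μ (fun s => (ρ s).re) (fun t => (f t).re) c d)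
    (h2 : DensityRep μ (fun s => (ρ s).im) (fun t => (f t).im) c d) :
    DensityRep μ ρ f c d := by
  intro x hx y hy hxy
  have ht : ∀ z ∈ Icc c d, Tendsto f (𝓝[>] z) (𝓝 (rightLim f z)) := fun z hz =>
    tendsto_rightLim_of_locBV hI ho hf (ho.out hc hd hz)
  have e1 := h1 x hx y hy hxy
  have e2 := h2 x hx y hy hxy
  rw [rightLim_re (ht x hx), rightLim_re (ht y hy)] at e1
  rw [rightLim_im (ht x hx), rightLim_im (ht y hy)] at e2
  have hi := hρ.mono_set (Ioc_subset_Ioc hx.1 hy.2)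
  apply Complex.ext
  · rw [Complex.sub_re, e1]
    exact integral_re hi
  · rw [Complex.sub_im, e2]
    exact integral_im hi

lemma DensityRep.congr {F : Type*} [NormedAddCommGroup F] [NormedSpace ℝ F] {ρ ρ' f : ℝ → F}
    (h : DensityRep μ ρ f c d) (e : ∀ s, ρ s = ρ' s) : DensityRep μ ρ' f c d := by
  rwa [← funext e]

variable {ι : Type} [Fintype ι]

lemma MeasureEqOn.densityRep {g : ℝ → ℝ} {h β ρ : ι → ℝ → ℝ} (H : MeasureEqOn I g h β)
    (ho : I.OrdConnected) (hh : ∀ j, LocallyBoundedVariationOn (h j) I)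
    (hc : c ∈ I) (hd : d ∈ I) (hcd : c < d)
    (hρ : ∀ j, Measurable (ρ j)) (hi : ∀ j, IntegrableOn (ρ j) (Ioc c d) μ)
    (hβ : ∀ j, DensityRep μ (ρ j) (β j) c d) :
    DensityRep μ (fun s => ∑ j, ρ j s * h j s) g c d := by
  obtain ⟨νg, ν, hg, hν, hE⟩ := H c hc d hd hcd
  intro x hx y hy hxy
  have hsub : Ioc x y ⊆ Ioc c d := Ioc_subset_Ioc hx.1 hy.2
  have hρh := fun j => integrableOn_mul_of_locBV ho (hh j) hc hd (hi j)
  rw [← hg x hx y hy hxy, hE _ hsub measurableSet_Ioc,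
    integral_finsetSum _ fun j _ => (hρh j).mono_set hsub]
  refine Finset.sum_congr rfl fun j _ => ?_
  refine sInt_eq_setIntegral measurableSet_Ioc (hρ j) ((hi j).mono_set hsub)
    (fun A hA hAm => ?_) ((hρh j).mono_set hsub)
  refine signedMeasure_eq_setIntegral hcd.le (hi j) (fun x hx y hy hxy => ?_) (hA.trans hsub) hAm
  rw [hν j x hx y hy hxy, hβ j x hx y hy hxy]

lemma measureEqOn_of_densityRep {g : ℝ → ℝ} {h β : ι → ℝ → ℝ}
    (ho : I.OrdConnected) (hh : ∀ j, LocallyBoundedVariationOn (h j) I)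
    (H : ∀ c ∈ I, ∀ d ∈ I, c < d → ∃ (μ : Measure ℝ) (ρ : ι → ℝ → ℝ),
      (∀ j, Measurable (ρ j)) ∧ (∀ j, Integrable (ρ j) μ) ∧
      (∀ j, DensityRep μ (ρ j) (β j) c d) ∧ DensityRep μ (fun s => ∑ j, ρ j s * h j s) g c d) :
    MeasureEqOn I g h β := by
  intro c hc d hd hcd
  obtain ⟨μ, ρ, hρ, hi, hβ, hg⟩ := H c hc d hd hcd
  have hρh := fun j => integrableOn_mul_of_locBV ho (hh j) hc hd (hi j).integrableOn
  have hsum : Integrable (fun s => ∑ j, ρ j s * h j s) (μ.restrict (Ioc c d)) :=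
    integrable_finsetSum _ fun j _ => hρh j
  refine ⟨(μ.restrict (Ioc c d)).withDensityᵥ fun s => ∑ j, ρ j s * h j s,
    fun j => μ.withDensityᵥ (ρ j), fun x hx y hy hxy => ?_, fun j x hx y hy hxy => ?_,
    fun E hE hEm => ?_⟩
  · rw [withDensityᵥ_apply hsum measurableSet_Ioc, Measure.restrict_restrict measurableSet_Ioc,
      inter_eq_left.2 (Ioc_subset_Ioc hx.1 hy.2), hg x hx y hy hxy]
  · rw [withDensityᵥ_apply (hi j) measurableSet_Ioc, hβ j x hx y hy hxy]
  · rw [withDensityᵥ_apply hsum hEm, Measure.restrict_restrict hEm, inter_eq_left.2 hE,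
      integral_finsetSum _ fun j _ => (hρh j).mono_set hE]
    refine Finset.sum_congr rfl fun j _ => (sInt_eq_setIntegral hEm (hρ j)
      (hi j).integrableOn (fun A hA hAm => ?_) ((hρh j).mono_set hE)).symm
    rw [withDensityᵥ_apply (hi j) hAm]

lemma integrableOn_mul_of_locBV_complex {ρ h : ℝ → ℂ} (ho : I.OrdConnected)
    (hh : LocallyBoundedVariationOn h I) (hc : c ∈ I) (hd : d ∈ I)
    (hρ : IntegrableOn ρ (Ioc c d) μ) : IntegrableOn (fun s => h s * ρ s) (Ioc c d) μ := by
  have h1 := integrableOn_mul_of_locBV ho (locBV_re hh) hc hd hρ.re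
  have h2 := integrableOn_mul_of_locBV ho (locBV_im hh) hc hd hρ.re
  have h3 := integrableOn_mul_of_locBV ho (locBV_re hh) hc hd hρ.im
  have h4 := integrableOn_mul_of_locBV ho (locBV_im hh) hc hd hρ.im
  refine ((Integrable.sub h1 h4).ofReal.add
    ((Integrable.add h2 h3).ofReal.mul_const Complex.I) : Integrable _ _).congr
    (Eventually.of_forall fun s => ?_)
  apply Complex.ext <;> simp <;> ring

lemma MeasureEqOnC.densityRep {g : ℝ → ℂ} {h β ρ : ι → ℝ → ℂ} (H : MeasureEqOnC I g h β)
    (hI : IsOpen I) (ho : I.OrdConnected) (hh : ∀ j, LocallyBoundedVariationOn (h j) I)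
    (hg : LocallyBoundedVariationOn g I) (hβ : ∀ j, LocallyBoundedVariationOn (β j) I)
    (hc : c ∈ I) (hd : d ∈ I) (hcd : c < d)
    (hρ : ∀ j, Measurable (ρ j)) (hi : ∀ j, IntegrableOn (ρ j) (Ioc c d) μ)
    (hr : ∀ j, DensityRep μ (ρ j) (β j) c d) :
    DensityRep μ (fun s => ∑ j, h j s * ρ j s) g c d := by
  have hm : ∀ j, Measurable (Sum.elim (fun j s => (ρ j s).re) (fun j s => (ρ j s).im) j) := by
    rintro (j | j)
    · exact Complex.measurable_re.comp (hρ j)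
    · exact Complex.measurable_im.comp (hρ j)
  have hi' : ∀ j, IntegrableOn (Sum.elim (fun j s => (ρ j s).re) (fun j s => (ρ j s).im) j)
      (Ioc c d) μ := by
    rintro (j | j)
    · exact (hi j).re
    · exact (hi j).im
  have hr' : ∀ j, DensityRep μ (Sum.elim (fun j s => (ρ j s).re) (fun j s => (ρ j s).im) j)
      (Sum.elim (fun j x => (β j x).re) (fun j x => (β j x).im) j) c d := by
    rintro (j | j)
    · exact (hr j).re hI ho (hβ j) hc hd (hi j)
    · exact (hr j).im hI ho (hβ j) hc hd (hi j)
  refine DensityRep.of_re_im hI ho hg hc hd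
    (integrable_finsetSum _ fun j _ =>
      integrableOn_mul_of_locBV_complex ho (hh j) hc hd (hi j)) ?_ ?_
  · refine (H.1.densityRep ho ?_ hc hd hcd hm hi' hr').congr fun s => ?_
    · rintro (j | j)
      · exact locBV_re (hh j)
      · exact (-Complex.imCLM).lipschitz.comp_locallyBoundedVariationOn (hh j)
    · simp only [Fintype.sum_sum_type, Sum.elim_inl, Sum.elim_inr, ← Finset.sum_add_distrib,
        Complex.re_sum, Complex.mul_re]
      exact Finset.sum_congr rfl fun j _ => by ring
  · refine (H.2.densityRep ho ?_ hc hd hcd hm hi' hr').congr fun s => ?_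
    · rintro (j | j)
      · exact locBV_im (hh j)
      · exact locBV_re (hh j)
    · simp only [Fintype.sum_sum_type, Sum.elim_inl, Sum.elim_inr, ← Finset.sum_add_distrib,
        Complex.im_sum, Complex.mul_im]
      exact Finset.sum_congr rfl fun j _ => by ring

lemma measureEqOnC_of_densityRep {g : ℝ → ℂ} {h β : ι → ℝ → ℂ}
    (hI : IsOpen I) (ho : I.OrdConnected) (hh : ∀ j, LocallyBoundedVariationOn (h j) I)
    (hg : LocallyBoundedVariationOn g I) (hβ : ∀ j, LocallyBoundedVariationOn (β j) I)
    (H : ∀ c ∈ I, ∀ d ∈ I, c < d → ∃ (μ : Measure ℝ) (ρ : ι → ℝ → ℂ),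
      (∀ j, Measurable (ρ j)) ∧ (∀ j, Integrable (ρ j) μ) ∧
      (∀ j, DensityRep μ (ρ j) (β j) c d) ∧ DensityRep μ (fun s => ∑ j, h j s * ρ j s) g c d) :
    MeasureEqOnC I g h β := by
  have key : ∀ c ∈ I, ∀ d ∈ I, c < d → ∃ (μ : Measure ℝ) (ρ : ι ⊕ ι → ℝ → ℝ),
      (∀ j, Measurable (ρ j)) ∧ (∀ j, Integrable (ρ j) μ) ∧
      (∀ j, DensityRep μ (ρ j)
        (Sum.elim (fun j x => (β j x).re) (fun j x => (β j x).im) j) c d) ∧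
      DensityRep μ (fun s => ∑ j, ρ j s *
        Sum.elim (fun j x => (h j x).re) (fun j x => -(h j x).im) j s)
        (fun x => (g x).re) c d ∧
      DensityRep μ (fun s => ∑ j, ρ j s *
        Sum.elim (fun j x => (h j x).im) (fun j x => (h j x).re) j s)
        (fun x => (g x).im) c d := by
    intro c hc d hd hcd
    obtain ⟨μ, ρ, hρ, hi, hr, hgr⟩ := H c hc d hd hcd
    have hgi : IntegrableOn (fun s => ∑ j, h j s * ρ j s) (Ioc c d) μ :=
      integrable_finsetSum _ fun j _ =>
        integrableOn_mul_of_locBV_complex ho (hh j) hc hd (hi j).integrableOn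
    refine ⟨μ, Sum.elim (fun j s => (ρ j s).re) (fun j s => (ρ j s).im), ?_, ?_, ?_, ?_, ?_⟩
    · rintro (j | j)
      · exact Complex.measurable_re.comp (hρ j)
      · exact Complex.measurable_im.comp (hρ j)
    · rintro (j | j)
      · exact (hi j).re
      · exact (hi j).im
    · rintro (j | j)
      · exact (hr j).re hI ho (hβ j) hc hd (hi j).integrableOn
      · exact (hr j).im hI ho (hβ j) hc hd (hi j).integrableOn
    · refine (hgr.re hI ho hg hc hd hgi).congr fun s => ?_
      simp only [Fintype.sum_sum_type, Sum.elim_inl, Sum.elim_inr, ← Finset.sum_add_distrib,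
        Complex.re_sum, Complex.mul_re]
      exact Finset.sum_congr rfl fun j _ => by ring
    · refine (hgr.im hI ho hg hc hd hgi).congr fun s => ?_
      simp only [Fintype.sum_sum_type, Sum.elim_inl, Sum.elim_inr, ← Finset.sum_add_distrib,
        Complex.im_sum, Complex.mul_im]
      exact Finset.sum_congr rfl fun j _ => by ring
  constructor
  · refine measureEqOn_of_densityRep ho ?_ fun c hc d hd hcd => ?_
    · rintro (j | j)
      · exact locBV_re (hh j)
      · exact (-Complex.imCLM).lipschitz.comp_locallyBoundedVariationOn (hh j)
    · obtain ⟨μ, ρ, h1, h2, h3, h4, -⟩ := key c hc d hd hcd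
      exact ⟨μ, ρ, h1, h2, h3, h4⟩
  · refine measureEqOn_of_densityRep ho ?_ fun c hc d hd hcd => ?_
    · rintro (j | j)
      · exact locBV_im (hh j)
      · exact locBV_re (hh j)
    · obtain ⟨μ, ρ, h1, h2, h3, -, h4⟩ := key c hc d hd hcd
      exact ⟨μ, ρ, h1, h2, h3, h4⟩

end Translation

section Density

variable {I : Set ℝ} {c d : ℝ} {μ : Measure ℝ}

lemma DensityRep.rightLim_eq {F : Type*} [NormedAddCommGroup F] [NormedSpace ℝ F] {ρ f : ℝ → F}
    (h : DensityRep μ ρ f c d)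
    (hμ : μ.restrict (Ioc c d) = μ) {t : ℝ} (ht : t ∈ Icc c d) :
    rightLim f t = rightLim f c + ∫ s in Iic t, ρ s ∂μ := by
  have e : ∫ s in Iic t, ρ s ∂μ = ∫ s in Ioc c t, ρ s ∂μ := by
    conv_lhs => rw [← hμ]
    rw [Measure.restrict_restrict measurableSet_Iic, inter_comm, Ioc_inter_Iic, inf_eq_right.2 ht.2]
  rw [e, ← h c ⟨le_rfl, ht.1.trans ht.2⟩ t ht ht.1, add_sub_cancel]

lemma DensityRep.leftLim_eq {ρ f : ℝ → ℂ} (h : DensityRep μ ρ f c d)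
    (hμ : μ.restrict (Ioc c d) = μ) (hρ : Integrable ρ μ) {t : ℝ} (ht : t ∈ Ioc c d)
    (hf : Tendsto f (𝓝[<] t) (𝓝 (leftLim f t))) :
    leftLim f t = rightLim f c + ∫ s in Iio t, ρ s ∂μ := by
  rw [← leftLim_rightLim hf]
  refine leftLim_eq_of_tendsto ?_
  refine ((tendsto_const_nhds (x := rightLim f c)).add
    (tendsto_setIntegral_Iic_left hρ t)).congr' ?_
  filter_upwards [Ioo_mem_nhdsLT ht.1] with s hs
  exact (h.rightLim_eq hμ ⟨hs.1.le, hs.2.le.trans ht.2⟩).symm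

lemma DensityRep.jumpC_eq {ρ f : ℝ → ℂ} [IsFiniteMeasure μ] (h : DensityRep μ ρ f c d)
    (hμ : μ.restrict (Ioc c d) = μ) (hρ : Integrable ρ μ) {t : ℝ} (ht : t ∈ Ioc c d)
    (hf : Tendsto f (𝓝[<] t) (𝓝 (leftLim f t))) :
    jumpC f t = μ.real {t} * ρ t := by
  rw [jumpC, h.rightLim_eq hμ (Ioc_subset_Icc_self ht), h.leftLim_eq hμ hρ ht hf,
    setIntegral_Iic_eq hρ, smul_eq_mul]
  ring

lemma DensityRep.eq_balPrim {ρ f : ℝ → ℂ} {r : ℂ} (h : DensityRep μ ρ f c d)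
    (hμ : μ.restrict (Ioc c d) = μ) (hρ : Integrable ρ μ) {t : ℝ} (ht : t ∈ Ioc c d)
    (hf : Tendsto f (𝓝[<] t) (𝓝 (leftLim f t)))
    (hb : f t = r * leftLim f t + (1 - r) * rightLim f t) :
    f t = balPrim r μ (rightLim f c) ρ t := by
  rw [hb, h.rightLim_eq hμ (Ioc_subset_Icc_self ht), h.leftLim_eq hμ hρ ht hf, balPrim,
    smul_eq_mul, smul_eq_mul]
  ring

lemma densityRep_balPrim {r C : ℂ} {G : ℝ → ℂ} (hG : Integrable G μ) :
    DensityRep μ G (balPrim r μ C G) c d := by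
  intro x _ y _ hxy
  rw [rightLim_balPrim hG, rightLim_balPrim hG, ← setIntegral_Iic_sub hG hxy]
  ring

lemma rBalancedC_balPrim {r C : ℂ} {G : ℝ → ℂ} (hG : Integrable G μ) (S : Set ℝ) :
    RBalancedC r S (balPrim r μ C G) := by
  refine ⟨locallyBoundedVariationOn_balPrim hG S, fun x _ => ?_⟩
  rw [rightLim_balPrim hG, leftLim_balPrim hG, balPrim, smul_eq_mul, smul_eq_mul]
  ring

lemma balPrim_apply {n : ℕ} {r : ℂ} {C : Fin n → ℂ} {G : ℝ → Fin n → ℂ} (hG : Integrable G μ)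
    (t : ℝ) (i : Fin n) : balPrim r μ C G t i = balPrim r μ (C i) (fun s => G s i) t := by
  have h := fun i => (integrable_pi_iff.1 hG) i
  simp only [balPrim, Pi.add_apply, Pi.smul_apply]
  rw [eval_integral fun i => (h i).integrableOn, eval_integral fun i => (h i).integrableOn]

lemma integrable_sum_sum_smul {E ι : Type*} [Fintype ι] [NormedAddCommGroup E] [NormedSpace ℂ E]
    {f : ℝ → ι → ι → ℂ} (hf : ∀ i j, Integrable (fun s => f s i j) μ) (T : ι → ι → E) :
    Integrable (fun s => ∑ i, ∑ j, f s i j • T i j) μ :=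
  integrable_finsetSum _ fun i _ => integrable_finsetSum _ fun j _ => (hf i j).smul_const _

lemma balPrim_congr {E : Type*} [NormedAddCommGroup E] [NormedSpace ℂ E] {r : ℂ} {C : E}
    {G G' : ℝ → E} (h : G =ᵐ[μ] G') (t : ℝ) : balPrim r μ C G t = balPrim r μ C G' t := by
  rw [balPrim, balPrim, integral_congr_ae (ae_restrict_of_ae h),
    integral_congr_ae (ae_restrict_of_ae h)]

end Density

section MatrixOperator

variable {n : ℕ}

/-- The continuous linear operator `v ↦ M v` on `ℂⁿ`. -/
def matrixCLM (M : Matrix (Fin n) (Fin n) ℂ) : (Fin n → ℂ) →L[ℂ] (Fin n → ℂ) :=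
  ∑ i, ∑ j, M i j • (ContinuousLinearMap.proj (R := ℂ) (φ := fun _ : Fin n => ℂ) j).smulRight
    (Pi.single i (1 : ℂ) : Fin n → ℂ)

lemma matrixCLM_apply (M : Matrix (Fin n) (Fin n) ℂ) (v : Fin n → ℂ) :
    matrixCLM M v = M.mulVec v := by
  ext i
  simp [matrixCLM, Matrix.mulVec, dotProduct, Pi.single_apply]

lemma isUnit_matrixCLM {M : Matrix (Fin n) (Fin n) ℂ} (h : M.det ≠ 0) : IsUnit (matrixCLM M) := by
  have hu : IsUnit M.det := isUnit_iff_ne_zero.2 h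
  refine ⟨⟨matrixCLM M, matrixCLM M⁻¹, ?_, ?_⟩, rfl⟩ <;> ext1 v
  · simp [matrixCLM_apply, Matrix.mul_nonsing_inv M hu]
  · simp [matrixCLM_apply, Matrix.nonsing_inv_mul M hu]

lemma isUnit_one_add_smul_matrixCLM {M : Matrix (Fin n) (Fin n) ℂ} {k : ℂ}
    (h : (1 + k • M).det ≠ 0) : IsUnit (1 + k • matrixCLM M) := by
  have e : 1 + k • matrixCLM M = matrixCLM (1 + k • M) := by
    ext1 v
    simp [matrixCLM_apply, Matrix.add_mulVec, Matrix.smul_mulVec]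
  rw [e]
  exact isUnit_matrixCLM h

end MatrixOperator

section System

variable {n : ℕ} {I : Set ℝ} {c d : ℝ} {μ : Measure ℝ} {r : ℂ}
  {φ M : ℝ → Matrix (Fin n) (Fin n) ℂ} {ψ b : ℝ → Fin n → ℂ}

/-- On `(c,d]`, the matrix measure `dφ` and the vector measure `dψ` have densities `M` and `b`
with respect to the finite measure `μ`, which is carried by `(c,d]`. -/
structure IsSysDensity (μ : Measure ℝ) (M : ℝ → Matrix (Fin n) (Fin n) ℂ) (b : ℝ → Fin n → ℂ)
    (φ : ℝ → Matrix (Fin n) (Fin n) ℂ) (ψ : ℝ → Fin n → ℂ) (c d : ℝ) : Prop where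
  finite : IsFiniteMeasure μ
  restrict_eq : μ.restrict (Ioc c d) = μ
  measurable_mat : ∀ i j, Measurable fun s => M s i j
  integrable_mat : ∀ i j, Integrable (fun s => M s i j) μ
  rep_mat : ∀ i j, DensityRep μ (fun s => M s i j) (fun t => φ t i j) c d
  measurable_vec : ∀ i, Measurable fun s => b s i
  integrable_vec : ∀ i, Integrable (fun s => b s i) μ
  rep_vec : ∀ i, DensityRep μ (fun s => b s i) (fun t => ψ t i) c d

lemma exists_isSysDensity (hI : IsOpen I) (ho : I.OrdConnected)
    (hφ : ∀ i j, LocallyBoundedVariationOn (fun x => φ x i j) I)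
    (hψ : ∀ i, LocallyBoundedVariationOn (fun x => ψ x i) I) (hc : c ∈ I) (hd : d ∈ I)
    (hcd : c ≤ d) : ∃ μ M b, IsSysDensity μ M b φ ψ c d := by
  obtain ⟨μ, ρ, hfin, hm, hi, hr⟩ := exists_densityRep (ι := (Fin n × Fin n) ⊕ Fin n)
    (f := Sum.elim (fun k x => φ x k.1 k.2) (fun i x => ψ x i)) hI ho
    (by
      rintro (k | i)
      · exact hφ k.1 k.2
      · exact hψ i) hc hd hcd
  have hr' : ∀ k, DensityRep (μ.restrict (Ioc c d)) (ρ k)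
      (Sum.elim (fun k x => φ x k.1 k.2) (fun i x => ψ x i) k) c d := by
    intro k x hx y hy hxy
    rw [hr k x hx y hy hxy, Measure.restrict_restrict measurableSet_Ioc,
      inter_eq_left.2 (Ioc_subset_Ioc hx.1 hy.2)]
  exact ⟨μ.restrict (Ioc c d), fun s => Matrix.of fun i j => ρ (.inl (i, j)) s,
    fun s i => ρ (.inr i) s, inferInstance, by
      rw [Measure.restrict_restrict measurableSet_Ioc, inter_self],
    fun i j => hm _, fun i j => (hi _).restrict, fun i j => hr' (.inl (i, j)),
    fun i => hm _, fun i => (hi _).restrict, fun i => hr' (.inr i)⟩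

namespace IsSysDensity

lemma stronglyMeasurable_matrixCLM (h : IsSysDensity μ M b φ ψ c d) : StronglyMeasurable fun s => matrixCLM (M s) := by
  unfold matrixCLM
  exact Finset.stronglyMeasurable_fun_sum _ fun i _ => Finset.stronglyMeasurable_fun_sum _
    fun j _ => (h.measurable_mat i j).stronglyMeasurable.smul_const _

lemma integrable_matrixCLM (h : IsSysDensity μ M b φ ψ c d) : Integrable (fun s => matrixCLM (M s)) μ :=
  integrable_sum_sum_smul h.integrable_mat _

lemma stronglyMeasurable_vec (h : IsSysDensity μ M b φ ψ c d) : StronglyMeasurable b :=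
  (measurable_pi_iff.2 h.measurable_vec).stronglyMeasurable

lemma integrable_vec_pi (h : IsSysDensity μ M b φ ψ c d) : Integrable b μ := integrable_pi_iff.2 h.integrable_vec

lemma isUnit (h : IsSysDensity μ M b φ ψ c d) (hI : IsOpen I) (ho : I.OrdConnected)
    (hφ : ∀ i j, LocallyBoundedVariationOn (fun x => φ x i j) I) (hc : c ∈ I) (hd : d ∈ I) {k : ℂ}
    (hdet : ∀ x ∈ I, (1 + k • Matrix.of fun i j => jumpC (fun t => φ t i j) x).det ≠ 0) (t : ℝ) :
    IsUnit (1 + (k * μ.real {t}) • matrixCLM (M t)) := by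
  have := h.finite
  refine isUnit_one_add_smul_matrixCLM ?_
  by_cases ht : t ∈ Ioc c d
  · have htI : t ∈ I := ho.out hc hd (Ioc_subset_Icc_self ht)
    convert hdet t htI using 2
    ext i j
    simp only [Matrix.add_apply, Matrix.smul_apply, Matrix.of_apply, smul_eq_mul]
    rw [(h.rep_mat i j).jumpC_eq h.restrict_eq (h.integrable_mat i j) ht
      (tendsto_leftLim_of_locBV hI ho (hφ i j) htI), mul_assoc]
  · have e : μ.real {t} = 0 := by
      rw [← h.restrict_eq, measureReal_restrict_apply (measurableSet_singleton t),
        singleton_inter_eq_empty.2 ht, measureReal_empty]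
    simp [e]

lemma densityRep_sol (h : IsSysDensity μ M b φ ψ c d) (hI : IsOpen I) (ho : I.OrdConnected)
    (hφ : ∀ i j, LocallyBoundedVariationOn (fun x => φ x i j) I)
    (hψ : ∀ i, LocallyBoundedVariationOn (fun x => ψ x i) I) (hc : c ∈ I) (hd : d ∈ I)
    (hcd : c < d) {y : ℝ → Fin n → ℂ} (hy : ∀ i, LocallyBoundedVariationOn (fun x => y x i) I)
    (hs : IsSysSolC I n φ ψ y) (i : Fin n) :
    DensityRep μ (fun s => (matrixCLM (M s) (y s) + b s) i) (fun t => y t i) c d := by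
  refine ((hs i).densityRep (ρ := Sum.elim (fun j s => M s i j) fun _ s => b s i)
    hI ho ?_ (hy i) ?_ hc hd hcd ?_ ?_ ?_).congr fun s => ?_
  · rintro (j | j)
    · exact hy j
    · exact locallyBoundedVariationOn_of_edist_le (v := fun _ => 0) monotone_const (by simp) I
  · rintro (j | j)
    · exact hφ i j
    · exact hψ i
  · rintro (j | j)
    · exact h.measurable_mat i j
    · exact h.measurable_vec i
  · rintro (j | j)
    · exact (h.integrable_mat i j).integrableOn
    · exact (h.integrable_vec i).integrableOn
  · rintro (j | j)
    · exact h.rep_mat i j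
    · exact h.rep_vec i
  · simp [matrixCLM_apply, Matrix.mulVec, dotProduct, mul_comm]

lemma integrable_sol (h : IsSysDensity μ M b φ ψ c d) (ho : I.OrdConnected) (hc : c ∈ I) (hd : d ∈ I)
    {y : ℝ → Fin n → ℂ} (hy : ∀ i, LocallyBoundedVariationOn (fun x => y x i) I) :
    Integrable (fun s => matrixCLM (M s) (y s) + b s) μ := by
  refine Integrable.add (integrable_pi_iff.2 fun i => ?_) h.integrable_vec_pi
  simp only [matrixCLM_apply, Matrix.mulVec, dotProduct]
  refine integrable_finsetSum _ fun j _ => ?_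
  have h1 := integrableOn_mul_of_locBV_complex ho (hy j) hc hd (h.integrable_mat i j).integrableOn
  rw [IntegrableOn, h.restrict_eq] at h1
  simpa only [mul_comm] using h1

lemma sol_eq_balPrim (h : IsSysDensity μ M b φ ψ c d) (hI : IsOpen I) (ho : I.OrdConnected)
    (hφ : ∀ i j, LocallyBoundedVariationOn (fun x => φ x i j) I)
    (hψ : ∀ i, LocallyBoundedVariationOn (fun x => ψ x i) I) (hc : c ∈ I) (hd : d ∈ I)
    (hcd : c < d) {y : ℝ → Fin n → ℂ} (hy : ∀ i, RBalancedC r I (fun x => y x i))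
    (hs : IsSysSolC I n φ ψ y) {t : ℝ} (ht : t ∈ Ioc c d) :
    y t = balPrim r μ (fun i => rightLim (fun x => y x i) c)
      (fun s => matrixCLM (M s) (y s) + b s) t := by
  have hi := h.integrable_sol ho hc hd fun i => (hy i).1
  have htI := ho.out hc hd (Ioc_subset_Icc_self ht)
  ext i
  rw [balPrim_apply hi]
  exact (h.densityRep_sol hI ho hφ hψ hc hd hcd (fun i => (hy i).1) hs i).eq_balPrim
    h.restrict_eq ((integrable_pi_iff.1 hi) i) ht
    (tendsto_leftLim_of_locBV hI ho (hy i).1 htI) ((hy i).2 t htI)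

lemma isSysSolC_balPrim (h : IsSysDensity μ M b φ ψ c d) (hφ : ∀ i j, LocallyBoundedVariationOn (fun x => φ x i j) (Ioo c d))
    (hψ : ∀ i, LocallyBoundedVariationOn (fun x => ψ x i) (Ioo c d)) {y : ℝ → Fin n → ℂ}
    {C : Fin n → ℂ} (hi : Integrable (fun s => matrixCLM (M s) (y s) + b s) μ)
    (hy : ∀ t, y t = balPrim r μ C (fun s => matrixCLM (M s) (y s) + b s) t) :
    (∀ i S, RBalancedC r S (fun x => y x i)) ∧ IsSysSolC (Ioo c d) n φ ψ y := by
  have hyi : ∀ i, (fun x => y x i) = balPrim r μ (C i)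
      fun s => (matrixCLM (M s) (y s) + b s) i := by
    intro i
    funext x
    rw [hy x, balPrim_apply hi]
  have hii := fun i => (integrable_pi_iff.1 hi) i
  have hb : ∀ i S, RBalancedC r S (fun x => y x i) := fun i S => by
    rw [hyi i]
    exact rBalancedC_balPrim (hii i) S
  refine ⟨hb, fun i => measureEqOnC_of_densityRep isOpen_Ioo ordConnected_Ioo ?_
    (hb i _).1 ?_ fun c' hc' d' hd' hcd' => ⟨μ, Sum.elim (fun j s => M s i j) fun _ s => b s i,
      ?_, ?_, ?_, ?_⟩⟩
  · rintro (j | j)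
    · exact (hb j _).1
    · exact locallyBoundedVariationOn_of_edist_le (v := fun _ => 0) monotone_const (by simp) _
  · rintro (j | j)
    · exact hφ i j
    · exact hψ i
  · rintro (j | j)
    · exact h.measurable_mat i j
    · exact h.measurable_vec i
  · rintro (j | j)
    · exact h.integrable_mat i j
    · exact h.integrable_vec i
  · have hsub : Icc c' d' ⊆ Icc c d := Icc_subset_Icc hc'.1.le hd'.2.le
    rintro (j | j) x hx z hz hxz
    · exact h.rep_mat i j x (hsub hx) z (hsub hz) hxz
    · exact h.rep_vec i x (hsub hx) z (hsub hz) hxz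
  · have h1 := densityRep_balPrim (r := r) (C := C i) (c := c') (d := d') (hii i)
    rw [← hyi i] at h1
    refine h1.congr fun s => ?_
    simp [matrixCLM_apply, Matrix.mulVec, dotProduct, mul_comm]

end IsSysDensity

end System

section Global

variable {n : ℕ} {I J : Set ℝ} {r : ℂ}
  {φ : ℝ → Matrix (Fin n) (Fin n) ℂ} {ψ : ℝ → Fin n → ℂ} {x₀ : ℝ}

lemma locBV_mono {F : Type*} [PseudoEMetricSpace F] {f : ℝ → F}
    (hf : LocallyBoundedVariationOn f I) (h : J ⊆ I) : LocallyBoundedVariationOn f J :=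
  fun x y hx hy => (hf x y (h hx) (h hy)).mono (inter_subset_inter_left _ h)

lemma exists_lt_lt_mem (hI : IsOpen I) {p q : ℝ} (hp : p ∈ I) (hq : q ∈ I) :
    ∃ c ∈ I, ∃ d ∈ I, c < p ∧ c < q ∧ p < d ∧ q < d := by
  have key : ∀ x ∈ I, (∃ c ∈ I, c < x) ∧ ∃ d ∈ I, x < d := by
    intro x hx
    constructor
    · obtain ⟨c, hc, hc'⟩ := ((hI.eventually_mem hx).filter_mono nhdsWithin_le_nhds |>.and
        (self_mem_nhdsWithin (s := Iio x))).exists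
      exact ⟨c, hc, hc'⟩
    · obtain ⟨c, hc, hc'⟩ := ((hI.eventually_mem hx).filter_mono nhdsWithin_le_nhds |>.and
        (self_mem_nhdsWithin (s := Ioi x))).exists
      exact ⟨c, hc, hc'⟩
  obtain ⟨c, hc, hc'⟩ := (key (min p q) (by rcases min_choice p q with e | e <;> rwa [e])).1
  obtain ⟨d, hd, hd'⟩ := (key (max p q) (by rcases max_choice p q with e | e <;> rwa [e])).2
  exact ⟨c, hc, d, hd, hc'.trans_le (min_le_left _ _), hc'.trans_le (min_le_right _ _),
    (le_max_left _ _).trans_lt hd', (le_max_right _ _).trans_lt hd'⟩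

/-- `y` is an `r`-balanced solution on `I` of `dy = dφ · y + dψ`, `y(x₀) = y₀`. -/
def IsIVPSol (r : ℂ) (I : Set ℝ) (φ : ℝ → Matrix (Fin n) (Fin n) ℂ) (ψ : ℝ → Fin n → ℂ) (x₀ : ℝ)
    (y₀ : Fin n → ℂ) (y : ℝ → Fin n → ℂ) : Prop :=
  (∀ i, RBalancedC r I (fun x => y x i)) ∧ IsSysSolC I n φ ψ y ∧ y x₀ = y₀

/-- The matrices `1 - (1 - r) Δ_{dφ}(x)` and `1 + r Δ_{dφ}(x)` are invertible for `x ∈ I`. -/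
def JumpsInvertible (r : ℂ) (I : Set ℝ) (φ : ℝ → Matrix (Fin n) (Fin n) ℂ) : Prop :=
  ∀ x ∈ I,
    Matrix.det ((1 : Matrix (Fin n) (Fin n) ℂ) -
      (1 - r) • Matrix.of (fun i j => jumpC (fun t => φ t i j) x)) ≠ 0 ∧
    Matrix.det ((1 : Matrix (Fin n) (Fin n) ℂ) +
      r • Matrix.of (fun i j => jumpC (fun t => φ t i j) x)) ≠ 0

lemma JumpsInvertible.isUnit (hdet : JumpsInvertible r I φ) {c d : ℝ} {μ : Measure ℝ}
    {M : ℝ → Matrix (Fin n) (Fin n) ℂ} {b : ℝ → Fin n → ℂ} (h : IsSysDensity μ M b φ ψ c d)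
    (hI : IsOpen I) (ho : I.OrdConnected)
    (hφ : ∀ i j, LocallyBoundedVariationOn (fun x => φ x i j) I) (hc : c ∈ I) (hd : d ∈ I) :
    (∀ t, IsUnit (1 - ((1 - r) * μ.real {t}) • matrixCLM (M t))) ∧
      ∀ t, IsUnit (1 + (r * μ.real {t}) • matrixCLM (M t)) := by
  refine ⟨fun t => ?_, h.isUnit hI ho hφ hc hd fun x hx => (hdet x hx).2⟩
  have h1 := h.isUnit hI ho hφ hc hd (k := -(1 - r)) (fun x hx => by
    rw [neg_smul, ← sub_eq_add_neg]
    exact (hdet x hx).1) t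
  convert h1 using 1
  ext1 v
  simp only [sub_apply, _root_.add_apply, smul_apply]
  module

lemma IsIVPSol.unique (hI : IsOpen I) (ho : I.OrdConnected)
    (hφ : ∀ i j, LocallyBoundedVariationOn (fun x => φ x i j) I)
    (hψ : ∀ i, LocallyBoundedVariationOn (fun x => ψ x i) I)
    (hdet : JumpsInvertible r I φ) (hx₀ : x₀ ∈ I) {y₀ : Fin n → ℂ} {y₁ y₂ : ℝ → Fin n → ℂ}
    (h₁ : IsIVPSol r I φ ψ x₀ y₀ y₁) (h₂ : IsIVPSol r I φ ψ x₀ y₀ y₂) {x : ℝ} (hx : x ∈ I) :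
    y₁ x = y₂ x := by
  obtain ⟨c, hc, d, hd, hcx, hcx₀, hxd, hx₀d⟩ := exists_lt_lt_mem hI hx hx₀
  have hcd : c < d := hcx.trans hxd
  obtain ⟨μ, M, b, h⟩ := exists_isSysDensity hI ho hφ hψ hc hd hcd.le
  have := h.finite
  obtain ⟨hu₁, hu₂⟩ := hdet.isUnit h hI ho hφ hc hd
  have key : ∀ y, IsIVPSol r I φ ψ x₀ y₀ y → ∃ (z : ℝ → Fin n → ℂ) (C : Fin n → ℂ),
      Integrable (fun s => matrixCLM (M s) (z s) + b s) μ ∧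
      (∀ t, z t = balPrim r μ C (fun s => matrixCLM (M s) (z s) + b s) t) ∧
      ∀ t ∈ Ioc c d, z t = y t := by
    intro y hy
    set C : Fin n → ℂ := fun i => rightLim (fun x => y x i) c
    set G := fun s => matrixCLM (M s) (y s) + b s with hG
    have hz : ∀ t ∈ Ioc c d, balPrim r μ C G t = y t := fun t ht =>
      (h.sol_eq_balPrim hI ho hφ hψ hc hd hcd hy.1 hy.2.1 ht).symm
    have hae : G =ᵐ[μ] fun s => matrixCLM (M s) (balPrim r μ C G s) + b s := by
      rw [← h.restrict_eq]
      filter_upwards [ae_restrict_mem measurableSet_Ioc] with s hs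
      rw [h.restrict_eq, hz s hs]
    exact ⟨balPrim r μ C G, C, (h.integrable_sol ho hc hd fun i => (hy.1 i).1).congr hae,
      balPrim_congr hae, hz⟩
  obtain ⟨z₁, C₁, hi₁, hz₁, e₁⟩ := key y₁ h₁
  obtain ⟨z₂, C₂, hi₂, hz₂, e₂⟩ := key y₂ h₂
  have hx₀m : x₀ ∈ Ioc c d := ⟨hcx₀, hx₀d.le⟩
  have e := balPrim_unique h.stronglyMeasurable_matrixCLM h.integrable_matrixCLM hu₁ hu₂ x₀
    hi₁ hi₂ hz₁ hz₂ (by rw [e₁ x₀ hx₀m, e₂ x₀ hx₀m, h₁.2.2, h₂.2.2])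
  rw [← e₁ x ⟨hcx, hxd.le⟩, ← e₂ x ⟨hcx, hxd.le⟩, e]

lemma exists_isIVPSol_Ioo (hI : IsOpen I) (ho : I.OrdConnected)
    (hφ : ∀ i j, LocallyBoundedVariationOn (fun x => φ x i j) I)
    (hψ : ∀ i, LocallyBoundedVariationOn (fun x => ψ x i) I)
    (hdet : JumpsInvertible r I φ) (x₀ : ℝ) (y₀ : Fin n → ℂ) {c d : ℝ} (hc : c ∈ I) (hd : d ∈ I)
    (hcd : c ≤ d) : ∃ y, IsIVPSol r (Ioo c d) φ ψ x₀ y₀ y := by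
  obtain ⟨μ, M, b, h⟩ := exists_isSysDensity hI ho hφ hψ hc hd hcd
  have := h.finite
  obtain ⟨hu₁, hu₂⟩ := hdet.isUnit h hI ho hφ hc hd
  have hsub : Ioo c d ⊆ I := Ioo_subset_Icc_self.trans (ho.out hc hd)
  obtain ⟨y, C, hi, hy, hy₀⟩ := exists_balPrim h.stronglyMeasurable_matrixCLM
    h.integrable_matrixCLM h.stronglyMeasurable_vec h.integrable_vec_pi hu₁ hu₂ x₀ y₀
  obtain ⟨h1, h2⟩ := h.isSysSolC_balPrim (fun i j => locBV_mono (hφ i j) hsub)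
    (fun i => locBV_mono (hψ i) hsub) hi hy
  exact ⟨y, fun i => h1 i _, h2, hy₀⟩

lemma IsIVPSol.mono {y₀ : Fin n → ℂ} {y : ℝ → Fin n → ℂ} (h : IsIVPSol r I φ ψ x₀ y₀ y)
    (hJ : J ⊆ I) : IsIVPSol r J φ ψ x₀ y₀ y :=
  ⟨fun i => ⟨locBV_mono (h.1 i).1 hJ, fun x hx => (h.1 i).2 x (hJ hx)⟩,
    fun i => ⟨fun c hc d hd => (h.2.1 i).1 c (hJ hc) d (hJ hd),
      fun c hc d hd => (h.2.1 i).2 c (hJ hc) d (hJ hd)⟩, h.2.2⟩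

lemma MeasureEqOn.congr {ι : Type} [Fintype ι] {g g' : ℝ → ℝ} {h h' β : ι → ℝ → ℝ}
    (H : MeasureEqOn I g h β) (hI : IsOpen I) (ho : I.OrdConnected) (hg : EqOn g g' I)
    (hh : ∀ j, EqOn (h j) (h' j) I) : MeasureEqOn I g' h' β := by
  intro c hc d hd hcd
  obtain ⟨νg, ν, h1, h2, h3⟩ := H c hc d hd hcd
  have hsub : Icc c d ⊆ I := ho.out hc hd
  have e : ∀ x ∈ Icc c d, rightLim g x = rightLim g' x := fun x hx =>
    rightLim_congr (hg.eventuallyEq_of_mem (hI.mem_nhds (hsub hx)))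
  refine ⟨νg, ν, fun x hx y hy hxy => ?_, h2, fun E hE hEm => ?_⟩
  · rw [h1 x hx y hy hxy, e x hx, e y hy]
  · rw [h3 E hE hEm]
    refine Finset.sum_congr rfl fun j _ => ?_
    have e2 : EqOn (h j) (h' j) E :=
      (hh j).mono (hE.trans (Ioc_subset_Icc_self.trans hsub))
    rw [sInt, sInt, setIntegral_congr_fun hEm e2, setIntegral_congr_fun hEm e2]

lemma IsSysSolC.congr {y y' : ℝ → Fin n → ℂ} (h : IsSysSolC I n φ ψ y) (hI : IsOpen I)
    (ho : I.OrdConnected) (e : EqOn y y' I) : IsSysSolC I n φ ψ y' := by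
  refine fun i => ⟨(h i).1.congr hI ho ?_ ?_, (h i).2.congr hI ho ?_ ?_⟩
  · intro x hx
    simp only [e hx]
  · rintro ((j | j) | (j | j)) x hx <;> simp [e hx]
  · intro x hx
    simp only [e hx]
  · rintro ((j | j) | (j | j)) x hx <;> simp [e hx]

lemma RBalancedC.congr {f g : ℝ → ℂ} (h : RBalancedC r I f) (hI : IsOpen I) (e : EqOn f g I) :
    RBalancedC r I g := by
  refine ⟨fun x y hx hy => ?_, fun x hx => ?_⟩
  · have h1 := h.1 x y hx hy
    rwa [BoundedVariationOn, eVariationOn.eq_of_eqOn (e.mono inter_subset_left)] at h1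
  · have e' := e.eventuallyEq_of_mem (hI.mem_nhds hx)
    rw [← e hx, ← leftLim_congr e', ← rightLim_congr e', h.2 x hx]

lemma exists_isIVPSol (hI : IsOpen I) (ho : I.OrdConnected)
    (hφ : ∀ i j, LocallyBoundedVariationOn (fun x => φ x i j) I)
    (hψ : ∀ i, LocallyBoundedVariationOn (fun x => ψ x i) I)
    (hdet : JumpsInvertible r I φ) (hx₀ : x₀ ∈ I) (y₀ : Fin n → ℂ) :
    ∃ y, IsIVPSol r I φ ψ x₀ y₀ y := by
  have hloc : ∀ p : ℝ × ℝ, ∃ y, p.1 ∈ I → p.2 ∈ I → p.1 ≤ p.2 →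
      IsIVPSol r (Ioo p.1 p.2) φ ψ x₀ y₀ y := by
    intro p
    by_cases hp : p.1 ∈ I ∧ p.2 ∈ I ∧ p.1 ≤ p.2
    · obtain ⟨y, hy⟩ := exists_isIVPSol_Ioo hI ho hφ hψ hdet x₀ y₀ hp.1 hp.2.1 hp.2.2
      exact ⟨y, fun _ _ _ => hy⟩
    · exact ⟨0, fun h1 h2 h3 => absurd ⟨h1, h2, h3⟩ hp⟩
  choose Y hY using hloc
  have hends : ∀ x, ∃ p : ℝ × ℝ, x ∈ I → p.1 ∈ I ∧ p.2 ∈ I ∧ x ∈ Ioo p.1 p.2 ∧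
      x₀ ∈ Ioo p.1 p.2 := by
    intro x
    by_cases hx : x ∈ I
    · obtain ⟨c, hc, d, hd, h1, h2, h3, h4⟩ := exists_lt_lt_mem hI hx hx₀
      exact ⟨(c, d), fun _ => ⟨hc, hd, ⟨h1, h3⟩, h2, h4⟩⟩
    · exact ⟨0, fun h => absurd h hx⟩
  choose P hP using hends
  have hYeq : ∀ p q : ℝ × ℝ, p.1 ∈ I → p.2 ∈ I → q.1 ∈ I → q.2 ∈ I → x₀ ∈ Ioo p.1 p.2 →
      x₀ ∈ Ioo q.1 q.2 → ∀ x ∈ Ioo p.1 p.2, x ∈ Ioo q.1 q.2 → Y p x = Y q x := by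
    intro p q hp1 hp2 hq1 hq2 hp hq x hxp hxq
    have hsub : Ioo p.1 p.2 ∩ Ioo q.1 q.2 ⊆ I :=
      inter_subset_left.trans (Ioo_subset_Icc_self.trans (ho.out hp1 hp2))
    exact IsIVPSol.unique (isOpen_Ioo.inter isOpen_Ioo) (ordConnected_Ioo.inter ordConnected_Ioo)
      (fun i j => locBV_mono (hφ i j) hsub) (fun i => locBV_mono (hψ i) hsub)
      (fun x hx => hdet x (hsub hx)) ⟨hp, hq⟩
      ((hY p hp1 hp2 (hp.1.trans hp.2).le).mono inter_subset_left)
      ((hY q hq1 hq2 (hq.1.trans hq.2).le).mono inter_subset_right) ⟨hxp, hxq⟩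
  set y : ℝ → Fin n → ℂ := fun x => Y (P x) x with hy
  have hsol : ∀ c ∈ I, ∀ d ∈ I, c < x₀ → x₀ < d → IsIVPSol r (Ioo c d) φ ψ x₀ y₀ y := by
    intro c hc d hd hcx hxd
    have hsub : Ioo c d ⊆ I := Ioo_subset_Icc_self.trans (ho.out hc hd)
    have e : EqOn (Y (c, d)) y (Ioo c d) := by
      intro x hx
      obtain ⟨h1, h2, h3, h4⟩ := hP x (hsub hx)
      exact hYeq (c, d) (P x) hc hd h1 h2 ⟨hcx, hxd⟩ h4 x hx h3
    obtain ⟨h1, h2, h3⟩ := hY (c, d) hc hd (hcx.trans hxd).le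
    refine ⟨fun i => (h1 i).congr isOpen_Ioo fun x hx => ?_,
      h2.congr isOpen_Ioo ordConnected_Ioo e, ?_⟩
    · simp only [e hx]
    · rw [← e ⟨hcx, hxd⟩, h3]
  have hex : ∀ p ∈ I, ∀ q ∈ I, ∃ c ∈ I, ∃ d ∈ I, p ∈ Ioo c d ∧ q ∈ Ioo c d ∧
      IsIVPSol r (Ioo c d) φ ψ x₀ y₀ y := by
    intro p hp q hq
    obtain ⟨c, hc, d, hd, h1, h2, h3, h4⟩ := exists_lt_lt_mem hI hp hx₀
    obtain ⟨c', hc', d', hd', h1', h2', h3', h4'⟩ := exists_lt_lt_mem hI hq hx₀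
    refine ⟨min c c', ?_, max d d', ?_, ⟨min_lt_of_left_lt h1, lt_max_of_lt_left h3⟩,
      ⟨min_lt_of_right_lt h1', lt_max_of_lt_right h3'⟩,
      hsol _ ?_ _ ?_ (min_lt_of_left_lt h2) (lt_max_of_lt_left h4)⟩
    · rcases min_choice c c' with e | e <;> rwa [e]
    · rcases max_choice d d' with e | e <;> rwa [e]
    · rcases min_choice c c' with e | e <;> rwa [e]
    · rcases max_choice d d' with e | e <;> rwa [e]
  refine ⟨y, fun i => ⟨fun p q hp hq => ?_, fun x hx => ?_⟩, fun i => ⟨?_, ?_⟩, ?_⟩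
  · obtain ⟨c, hc, d, hd, hpm, hqm, h⟩ := hex p hp q hq
    refine ((h.1 i).1 p q hpm hqm).mono fun x hx => ⟨?_, hx.2⟩
    exact ⟨hpm.1.trans_le hx.2.1, hx.2.2.trans_lt hqm.2⟩
  · obtain ⟨c, hc, d, hd, hpm, hqm, h⟩ := hex x hx x hx
    exact (h.1 i).2 x hpm
  · intro p hp q hq hpq
    obtain ⟨c, hc, d, hd, hpm, hqm, h⟩ := hex p hp q hq
    exact (h.2.1 i).1 p hpm q hqm hpq
  · intro p hp q hq hpq
    obtain ⟨c, hc, d, hd, hpm, hqm, h⟩ := hex p hp q hq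
    exact (h.2.1 i).2 p hpm q hqm hpq
  · obtain ⟨c, hc, d, hd, hpm, hqm, h⟩ := hex x₀ hx₀ x₀ hx₀
    exact h.2.2

open scoped ComplexConjugate

lemma locBV_conj {f : ℝ → ℂ} (hf : LocallyBoundedVariationOn f I) :
    LocallyBoundedVariationOn (fun t => conj (f t)) I :=
  (Complex.conjCLE : ℂ →L[ℝ] ℂ).lipschitz.comp_locallyBoundedVariationOn hf

lemma rightLim_conj {f : ℝ → ℂ} {x : ℝ} (hf : Tendsto f (𝓝[>] x) (𝓝 (rightLim f x))) :
    rightLim (fun t => conj (f t)) x = conj (rightLim f x) :=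
  rightLim_eq_of_tendsto ((Complex.continuous_conj.tendsto _).comp hf)

lemma leftLim_conj {f : ℝ → ℂ} {x : ℝ} (hf : Tendsto f (𝓝[<] x) (𝓝 (leftLim f x))) :
    leftLim (fun t => conj (f t)) x = conj (leftLim f x) :=
  leftLim_eq_of_tendsto ((Complex.continuous_conj.tendsto _).comp hf)

lemma DensityRep.conj {μ : Measure ℝ} {c d : ℝ} {ρ f : ℝ → ℂ} (h : DensityRep μ ρ f c d)
    (hI : IsOpen I) (ho : I.OrdConnected) (hf : LocallyBoundedVariationOn f I) (hc : c ∈ I)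
    (hd : d ∈ I) : DensityRep μ (fun s => conj (ρ s)) (fun t => conj (f t)) c d := by
  intro x hx y hy hxy
  have ht : ∀ z ∈ Icc c d, Tendsto f (𝓝[>] z) (𝓝 (rightLim f z)) := fun z hz =>
    tendsto_rightLim_of_locBV hI ho hf (ho.out hc hd hz)
  rw [rightLim_conj (ht x hx), rightLim_conj (ht y hy), ← map_sub, h x hx y hy hxy]
  exact integral_conj.symm

lemma DensityRep.congr_right {μ : Measure ℝ} {c d : ℝ} {ρ f g : ℝ → ℂ}
    (h : DensityRep μ ρ f c d) (hI : IsOpen I) (ho : I.OrdConnected) (hc : c ∈ I) (hd : d ∈ I)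
    (e : EqOn f g I) : DensityRep μ ρ g c d := by
  have e' : ∀ x ∈ Icc c d, rightLim f x = rightLim g x := fun x hx =>
    rightLim_congr (e.eventuallyEq_of_mem (hI.mem_nhds (ho.out hc hd hx)))
  intro x hx y hy hxy
  rw [← e' x hx, ← e' y hy, h x hx y hy hxy]

lemma IsIVPSol.conj (hI : IsOpen I) (ho : I.OrdConnected)
    (hφ : ∀ i j, LocallyBoundedVariationOn (fun x => φ x i j) I)
    (hψ : ∀ i, LocallyBoundedVariationOn (fun x => ψ x i) I) {y₀ : Fin n → ℂ}
    {y : ℝ → Fin n → ℂ} (h : IsIVPSol r I φ ψ x₀ y₀ y) (hr : r.im = 0)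
    (hφr : ∀ x ∈ I, ∀ i j, (φ x i j).im = 0) (hψr : ∀ x ∈ I, ∀ i, (ψ x i).im = 0)
    (hy₀ : ∀ i, (y₀ i).im = 0) : IsIVPSol r I φ ψ x₀ y₀ fun x i => conj (y x i) := by
  refine ⟨fun i => ⟨locBV_conj (h.1 i).1, fun x hx => ?_⟩, fun i => ?_, ?_⟩
  · rw [rightLim_conj (tendsto_rightLim_of_locBV hI ho (h.1 i).1 hx),
      leftLim_conj (tendsto_leftLim_of_locBV hI ho (h.1 i).1 hx)]
    have h1 := congrArg (starRingEnd ℂ) ((h.1 i).2 x hx)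
    rw [map_add, map_mul, map_mul, map_sub, map_one, Complex.conj_eq_iff_im.2 hr] at h1
    exact h1
  · refine measureEqOnC_of_densityRep hI ho ?_ (locBV_conj (h.1 i).1) ?_ fun c hc d hd hcd => ?_
    · rintro (j | j)
      · exact locBV_conj (h.1 j).1
      · exact locallyBoundedVariationOn_of_edist_le (v := fun _ => 0) monotone_const (by simp) _
    · rintro (j | j)
      · exact hφ i j
      · exact hψ i
    · obtain ⟨μ, M, b, hD⟩ := exists_isSysDensity hI ho hφ hψ hc hd hcd.le
      refine ⟨μ, Sum.elim (fun j s => starRingEnd ℂ (M s i j)) fun _ s => starRingEnd ℂ (b s i),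
        ?_, ?_, ?_, ?_⟩
      · rintro (j | j)
        · exact Complex.continuous_conj.measurable.comp (hD.measurable_mat i j)
        · exact Complex.continuous_conj.measurable.comp (hD.measurable_vec i)
      · rintro (j | j)
        · exact Complex.conjLIE.toContinuousLinearEquiv.toContinuousLinearMap.integrable_comp
            (hD.integrable_mat i j)
        · exact Complex.conjLIE.toContinuousLinearEquiv.toContinuousLinearMap.integrable_comp
            (hD.integrable_vec i)
      · rintro (j | j)
        · exact ((hD.rep_mat i j).conj hI ho (hφ i j) hc hd).congr_right hI ho hc hd
            fun x hx => Complex.conj_eq_iff_im.2 (hφr x hx i j)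
        · exact ((hD.rep_vec i).conj hI ho (hψ i) hc hd).congr_right hI ho hc hd
            fun x hx => Complex.conj_eq_iff_im.2 (hψr x hx i)
      · refine ((hD.densityRep_sol hI ho hφ hψ hc hd hcd (fun i => (h.1 i).1) h.2.1 i).conj
          hI ho (h.1 i).1 hc hd).congr fun s => ?_
        simp [matrixCLM_apply, Matrix.mulVec, dotProduct, mul_comm]
  · ext i
    simp only [h.2.2]
    exact Complex.conj_eq_iff_im.2 (hy₀ i)

lemma isOpen_EI (a b : EReal) : IsOpen (EI a b) :=
  (isOpen_lt continuous_const continuous_coe_real_ereal).inter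
    (isOpen_lt continuous_coe_real_ereal continuous_const)

lemma ordConnected_EI (a b : EReal) : (EI a b).OrdConnected :=
  ⟨fun _ hx _ hy _ hz => ⟨hx.1.trans_le (EReal.coe_le_coe_iff.2 hz.1),
    (EReal.coe_le_coe_iff.2 hz.2).trans_lt hy.2⟩⟩

end Global

end

/-- Theorem 3.1: existence and uniqueness of `r`-balanced solutions of the
linear system `dy = dφ y + dψ`, `y(x₀) = y₀`, and reality of the solution for real data. -/
theorem statement0 (a b : EReal) (hab : a < b) (n : ℕ) (r : ℂ)
    (φ : ℝ → Matrix (Fin n) (Fin n) ℂ) (ψ : ℝ → Fin n → ℂ)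
    (hφ : ∀ i j, LocallyBoundedVariationOn (fun x => φ x i j) (EI a b))
    (hψ : ∀ i, LocallyBoundedVariationOn (fun x => ψ x i) (EI a b))
    (hdet : ∀ x ∈ EI a b,
      Matrix.det ((1 : Matrix (Fin n) (Fin n) ℂ) -
        (1 - r) • Matrix.of (fun i j => jumpC (fun t => φ t i j) x)) ≠ 0 ∧
      Matrix.det ((1 : Matrix (Fin n) (Fin n) ℂ) +
        r • Matrix.of (fun i j => jumpC (fun t => φ t i j) x)) ≠ 0)
    (x₀ : ℝ) (hx₀ : x₀ ∈ EI a b) (y₀ : Fin n → ℂ) :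
    (∃ y : ℝ → Fin n → ℂ,
      (∀ i, RBalancedC r (EI a b) (fun x => y x i)) ∧
        IsSysSolC (EI a b) n φ ψ y ∧ y x₀ = y₀) ∧
    (∀ y₁ y₂ : ℝ → Fin n → ℂ,
      ((∀ i, RBalancedC r (EI a b) (fun x => y₁ x i)) ∧
        IsSysSolC (EI a b) n φ ψ y₁ ∧ y₁ x₀ = y₀) →
      ((∀ i, RBalancedC r (EI a b) (fun x => y₂ x i)) ∧
        IsSysSolC (EI a b) n φ ψ y₂ ∧ y₂ x₀ = y₀) →
      ∀ x ∈ EI a b, y₁ x = y₂ x) ∧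
    ((r.im = 0 ∧ (∀ x ∈ EI a b, ∀ i j, (φ x i j).im = 0) ∧
        (∀ x ∈ EI a b, ∀ i, (ψ x i).im = 0) ∧ (∀ i, (y₀ i).im = 0)) →
      ∀ y : ℝ → Fin n → ℂ,
        ((∀ i, RBalancedC r (EI a b) (fun x => y x i)) ∧
          IsSysSolC (EI a b) n φ ψ y ∧ y x₀ = y₀) →
        ∀ x ∈ EI a b, ∀ i, (y x i).im = 0) := by
  have hI := isOpen_EI a b
  have ho := ordConnected_EI a b
  refine ⟨exists_isIVPSol hI ho hφ hψ hdet hx₀ y₀,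
    fun y₁ y₂ h₁ h₂ x hx => IsIVPSol.unique hI ho hφ hψ hdet hx₀ h₁ h₂ hx, ?_⟩
  rintro ⟨hr, hφr, hψr, hy₀⟩ y hy x hx i
  have h := IsIVPSol.unique hI ho hφ hψ hdet hx₀ hy
    (IsIVPSol.conj hI ho hφ hψ hy hr hφr hψr hy₀) hx
  exact Complex.conj_eq_iff_im.1 (congrFun h i).symm
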